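/- The congruence action of GL_5(ZMod 3) on the set of 3-dimensional ZMod 3-subspaces of AS_5(ZMod 3) has exactly 22 orbits; moreover, exactly 16 of these orbits consist of subspaces V with trivial radical rad(V) = 0, and exactly 6 consist of subspaces with rad(V) ≠ 0. -/

import Mathlib

open Matrix

/-- The 3-dimensional `ZMod 3`-subspaces of the antisymmetric `5 × 5` matrices over
`ZMod 3`. -/
def Gr3AS5 : Type :=
  {V : Submodule (ZMod 3) (Matrix (Fin 5) (Fin 5) (ZMod 3)) //
    (∀ X ∈ V, Xᵀ = -X) ∧ Module.finrank (ZMod 3) V = 3}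

/-- Congruence relation: `V ∼ W` iff `W = P • V = {P * X * Pᵀ : X ∈ V}` for some
`P ∈ GL 5 (ZMod 3)`. -/
def congRel3AS5 (V W : Gr3AS5) : Prop :=
  ∃ P : GL (Fin 5) (ZMod 3),
    (W.1 : Set (Matrix (Fin 5) (Fin 5) (ZMod 3))) =
      (fun X => (P : Matrix (Fin 5) (Fin 5) (ZMod 3)) * X *
        (P : Matrix (Fin 5) (Fin 5) (ZMod 3))ᵀ) ''
        (V.1 : Set (Matrix (Fin 5) (Fin 5) (ZMod 3)))

/-- The radical of a subspace `V` of `5 × 5` matrices: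
`{v : (ZMod 3)^5 | X.mulVec v = 0 for all X ∈ V}`. -/
def radOf (V : Submodule (ZMod 3) (Matrix (Fin 5) (Fin 5) (ZMod 3))) :
    Set (Fin 5 → ZMod 3) :=
  {v | ∀ X ∈ V, X.mulVec v = 0}

abbrev M55 := Matrix (Fin 5) (Fin 5) (ZMod 3)

/-- Entry `(i, j)` of the `5 × 5` matrix with base three code `c`. -/
def ent (c i j : ℕ) : ℕ := c / 3 ^ (5 * i + j) % 3

/-- The matrix over `ZMod 3` with base three code `c`. -/
def matP (c : ℕ) : M55 := Matrix.of fun i j => (ent c i j : ZMod 3)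

/-- The antisymmetric matrix with the given list of upper triangular entries. -/
def asM (l : List ℕ) : M55 :=
  !![0, (l.getD 0 0 : ZMod 3), (l.getD 1 0 : ZMod 3), (l.getD 2 0 : ZMod 3), (l.getD 3 0 : ZMod 3);
    -(l.getD 0 0 : ZMod 3), 0, (l.getD 4 0 : ZMod 3), (l.getD 5 0 : ZMod 3), (l.getD 6 0 : ZMod 3);
    -(l.getD 1 0 : ZMod 3), -(l.getD 4 0 : ZMod 3), 0, (l.getD 7 0 : ZMod 3), (l.getD 8 0 : ZMod 3);
    -(l.getD 2 0 : ZMod 3), -(l.getD 5 0 : ZMod 3), -(l.getD 7 0 : ZMod 3), 0, (l.getD 9 0 : ZMod 3);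
    -(l.getD 3 0 : ZMod 3), -(l.getD 6 0 : ZMod 3), -(l.getD 8 0 : ZMod 3), -(l.getD 9 0 : ZMod 3), 0]

def dot : List ℕ → List ℕ → ℕ
  | a :: as, b :: bs => a * b + dot as bs
  | _, _ => 0

/-- Remove trailing zeros. -/
def trim : List ℕ → List ℕ
  | [] => []
  | a :: as => match trim as with
    | [] => if a = 0 then [] else [a]
    | b :: bs => a :: b :: bs

def act (m : List (List ℕ)) (x : List ℕ) : List ℕ := m.map fun r => dot r x % 3

def prs : List (ℕ × ℕ) :=
  [(0, 1), (0, 2), (0, 3), (0, 4), (1, 2), (1, 3), (1, 4), (2, 3), (2, 4), (3, 4)]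

/-- Second exterior power of the matrix with code `c`, with trimmed rows. -/
def lam (c : ℕ) : List (List ℕ) :=
  prs.map fun p => trim (prs.map fun q =>
    (ent c p.1 q.1 * ent c p.2 q.2 + 2 * (ent c p.1 q.2 * ent c p.2 q.1)) % 3)

def negRows : List (List ℕ) :=
  (List.range 10).map fun r => trim ((List.range 10).map fun j => if j = r then 2 else 0)

/-- Rows of the map `x ↦ x + k * x_pv * u`. -/
def transRows (u : List ℕ) (pv k : ℕ) : List (List ℕ) :=
  (List.range 10).map fun r => trim ((List.range 10).map fun j =>
    ((if j = r then 1 else 0) + (if j = pv then k * u.getD r 0 else 0)) % 3)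

lemma dot_trim (r x : List ℕ) : dot (trim r) x = dot r x := by
  induction r generalizing x with
  | nil => rfl
  | cons a as ih =>
    cases x with
    | nil =>
      have : ∀ l, dot l [] = 0 := by intro l; cases l <;> rfl
      rw [this, this]
    | cons b bs =>
      have h := ih bs
      simp only [trim]
      cases ht : trim as with
      | nil =>
        rw [ht] at h
        by_cases ha : a = 0
        · simp only [ha, if_true, dot, ← h]; simp
        · simp only [ha, if_false, dot, ← h]
      | cons c cs =>
        rw [ht] at h
        simp only [dot, ← h]

lemma exists_list10 (x : List ℕ) (hx : x.length = 10) :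
    ∃ a b c d e f g h i j, x = [a, b, c, d, e, f, g, h, i, j] := by
  match x, hx with
  | [a, b, c, d, e, f, g, h, i, j], _ => exact ⟨a, b, c, d, e, f, g, h, i, j, rfl⟩

lemma three_zero : (3 : ZMod 3) = 0 := by decide
lemma two_neg : (2 : ZMod 3) = -1 := by decide

lemma asM_act_lam (c : ℕ) (x : List ℕ) (hx : x.length = 10) :
    asM (act (lam c) x) = matP c * asM x * (matP c)ᵀ := by
  obtain ⟨x0, x1, x2, x3, x4, x5, x6, x7, x8, x9, rfl⟩ := exists_list10 x hx
  have key : ∀ i j : Fin 5, (matP c * asM [x0, x1, x2, x3, x4, x5, x6, x7, x8, x9] * (matP c)ᵀ) i j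
      = (matP c i 0 * matP c j 1 - matP c i 1 * matP c j 0) * x0
      + (matP c i 0 * matP c j 2 - matP c i 2 * matP c j 0) * x1
      + (matP c i 0 * matP c j 3 - matP c i 3 * matP c j 0) * x2
      + (matP c i 0 * matP c j 4 - matP c i 4 * matP c j 0) * x3
      + (matP c i 1 * matP c j 2 - matP c i 2 * matP c j 1) * x4
      + (matP c i 1 * matP c j 3 - matP c i 3 * matP c j 1) * x5
      + (matP c i 1 * matP c j 4 - matP c i 4 * matP c j 1) * x6
      + (matP c i 2 * matP c j 3 - matP c i 3 * matP c j 2) * x7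
      + (matP c i 2 * matP c j 4 - matP c i 4 * matP c j 2) * x8
      + (matP c i 3 * matP c j 4 - matP c i 4 * matP c j 3) * x9 := by
    intro i j
    simp [Matrix.mul_apply, Fin.sum_univ_five, asM]
    ring
  have row : ∀ p1 p2 : Fin 5, ((dot (trim (prs.map fun q =>
      (ent c p1 q.1 * ent c p2 q.2 + 2 * (ent c p1 q.2 * ent c p2 q.1)) % 3))
      [x0, x1, x2, x3, x4, x5, x6, x7, x8, x9] % 3 : ℕ) : ZMod 3) =
      (matP c * asM [x0, x1, x2, x3, x4, x5, x6, x7, x8, x9] * (matP c)ᵀ) p1 p2 := by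
    intro p1 p2
    rw [key, dot_trim]
    simp only [prs, List.map, dot]
    push_cast [ZMod.natCast_mod, two_neg]
    simp only [matP, Matrix.of_apply]
    simp
    ring
  have anti : ∀ i j : Fin 5, (matP c * asM [x0, x1, x2, x3, x4, x5, x6, x7, x8, x9] * (matP c)ᵀ) i j
    = - (matP c * asM [x0, x1, x2, x3, x4, x5, x6, x7, x8, x9] * (matP c)ᵀ) j i := by
    intro i j
    rw [key, key]; ring
  have dg : ∀ i : Fin 5, (matP c * asM [x0, x1, x2, x3, x4, x5, x6, x7, x8, x9] * (matP c)ᵀ) i i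
    = 0 := by
    intro i
    rw [key]; ring
  generalize hM : matP c * asM [x0, x1, x2, x3, x4, x5, x6, x7, x8, x9] * (matP c)ᵀ = M at *
  clear key hM
  have r01 := row 0 1
  have r02 := row 0 2
  have r03 := row 0 3
  have r04 := row 0 4
  have r12 := row 1 2
  have r13 := row 1 3
  have r14 := row 1 4
  have r23 := row 2 3
  have r24 := row 2 4
  have r34 := row 3 4
  clear row
  have e : M = !![0, M 0 1, M 0 2, M 0 3, M 0 4; -M 0 1, 0, M 1 2, M 1 3, M 1 4;
     -M 0 2, -M 1 2, 0, M 2 3, M 2 4; -M 0 3, -M 1 3, -M 2 3, 0, M 3 4;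
     -M 0 4, -M 1 4, -M 2 4, -M 3 4, 0] := by
    ext i j
    fin_cases i <;> fin_cases j <;> simp [dg] <;> exact anti _ _
  rw [e, ← r01, ← r02, ← r03, ← r04, ← r12, ← r13, ← r14, ← r23, ← r24, ← r34]
  rfl

lemma asM_neg (x : List ℕ) (hx : x.length = 10) : asM (act negRows x) = - asM x := by
  obtain ⟨x0, x1, x2, x3, x4, x5, x6, x7, x8, x9, rfl⟩ := exists_list10 x hx
  have h : act negRows [x0, x1, x2, x3, x4, x5, x6, x7, x8, x9] =
    [2 * x0 % 3, 2 * x1 % 3, 2 * x2 % 3, 2 * x3 % 3, 2 * x4 % 3, 2 * x5 % 3, 2 * x6 % 3,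
      2 * x7 % 3, 2 * x8 % 3, 2 * x9 % 3] := by
    simp [act, negRows, dot_trim, List.range_succ, dot]
  rw [h]
  ext i j
  fin_cases i <;> fin_cases j <;> simp [asM, two_neg]

lemma asM_trans (u x : List ℕ) (hx : x.length = 10) (pv k : ℕ) (hp : pv < 10) :
    asM (act (transRows u pv k) x) = asM x + ((k * x.getD pv 0 : ℕ) : ZMod 3) • asM u := by
  obtain ⟨x0, x1, x2, x3, x4, x5, x6, x7, x8, x9, rfl⟩ := exists_list10 x hx
  have row : ∀ r < 10, ((dot (trim ((List.range 10).map fun j =>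
    ((if j = r then 1 else 0) + (if j = pv then k * u.getD r 0 else 0)) % 3))
      [x0, x1, x2, x3, x4, x5, x6, x7, x8, x9] % 3 : ℕ) : ZMod 3) =
     ([x0, x1, x2, x3, x4, x5, x6, x7, x8, x9].getD r 0 : ℕ) +
     ((k * [x0, x1, x2, x3, x4, x5, x6, x7, x8, x9].getD pv 0 : ℕ) : ZMod 3) * (u.getD r 0 : ℕ) := by
    intro r hr
    have hsel : ∀ (w : ZMod 3) (t : ℕ), t < 10 →
      w * ([x0, x1, x2, x3, x4, x5, x6, x7, x8, x9].getD t 0 : ℕ) =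
      (if 0 = t then w else 0) * x0 + (if 1 = t then w else 0) * x1 + (if 2 = t then w else 0) * x2
      + (if 3 = t then w else 0) * x3 + (if 4 = t then w else 0) * x4
      + (if 5 = t then w else 0) * x5 + (if 6 = t then w else 0) * x6
      + (if 7 = t then w else 0) * x7 + (if 8 = t then w else 0) * x8
      + (if 9 = t then w else 0) * x9 := by
      intro w t ht
      interval_cases t <;> simp
    rw [dot_trim, ZMod.natCast_mod]
    have e1 := hsel 1 r hr
    have e2 := hsel (k * (u.getD r 0 : ℕ)) pv hp
    rw [one_mul] at e1
    rw [e1]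
    rw [show ((k * [x0, x1, x2, x3, x4, x5, x6, x7, x8, x9].getD pv 0 : ℕ) : ZMod 3) *
      (u.getD r 0 : ℕ) = (k * (u.getD r 0 : ℕ)) *
        ([x0, x1, x2, x3, x4, x5, x6, x7, x8, x9].getD pv 0 : ℕ) by push_cast; ring, e2]
    clear e1 e2 hsel
    generalize u.getD r 0 = w
    rw [show List.range 10 = [0, 1, 2, 3, 4, 5, 6, 7, 8, 9] from rfl]
    simp only [List.map, dot]
    push_cast [ZMod.natCast_mod]
    ring
  have h : ∀ r < 10, (((act (transRows u pv k) [x0, x1, x2, x3, x4, x5, x6, x7, x8, x9]).getD r 0 : ℕ) : ZMod 3)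
     = ([x0, x1, x2, x3, x4, x5, x6, x7, x8, x9].getD r 0 : ℕ) +
     ((k * [x0, x1, x2, x3, x4, x5, x6, x7, x8, x9].getD pv 0 : ℕ) : ZMod 3) * (u.getD r 0 : ℕ) := by
    intro r hr
    rw [← row r hr]
    simp only [act, transRows, List.map_map]
    rw [List.getD_eq_getElem _ _ (by simpa using hr)]
    simp
  generalize act (transRows u pv k) [x0, x1, x2, x3, x4, x5, x6, x7, x8, x9] = y at *
  generalize [x0, x1, x2, x3, x4, x5, x6, x7, x8, x9] = z at *
  ext i j
  have h0 := h 0 (by norm_num)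
  have h1 := h 1 (by norm_num)
  have h2 := h 2 (by norm_num)
  have h3 := h 3 (by norm_num)
  have h4 := h 4 (by norm_num)
  have h5 := h 5 (by norm_num)
  have h6 := h 6 (by norm_num)
  have h7 := h 7 (by norm_num)
  have h8 := h 8 (by norm_num)
  have h9 := h 9 (by norm_num)
  simp only [asM, h0, h1, h2, h3, h4, h5, h6, h7, h8, h9]
  generalize ((k * z.getD pv 0 : ℕ) : ZMod 3) = t
  fin_cases i <;> fin_cases j <;> simp <;> ring

/-- The ten base three digits of a code, most significant first. -/
def digs (c : ℕ) : List ℕ := (List.range 10).map fun k => c / 3 ^ (9 - k) % 3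

lemma digs_length (c : ℕ) : (digs c).length = 10 := by simp [digs]

lemma act_lam_length (c : ℕ) (x : List ℕ) : (act (lam c) x).length = 10 := by
  simp [act, lam, prs]

/-- Congruence by `P` as a linear map. -/
def cong (P : M55) : M55 →ₗ[ZMod 3] M55 where
  toFun X := P * X * Pᵀ
  map_add' X Y := by rw [mul_add, add_mul]
  map_smul' a X := by simp

lemma cong_apply (P X : M55) : cong P X = P * X * Pᵀ := rfl

lemma cong_cong {P Q : M55} (h : Q * P = 1) (X : M55) : cong Q (cong P X) = X := by
  have h' : Pᵀ * Qᵀ = 1 := by rw [← Matrix.transpose_mul, h, Matrix.transpose_one]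
  calc Q * (P * X * Pᵀ) * Qᵀ = (Q * P) * X * (Pᵀ * Qᵀ) := by simp only [Matrix.mul_assoc]
    _ = X := by rw [h, h', Matrix.one_mul, Matrix.mul_one]

lemma cong_inj {P Q : M55} (h : Q * P = 1) : Function.Injective (cong P) :=
  Function.LeftInverse.injective (cong_cong h)

lemma cong_anti (P X : M55) (h : Xᵀ = -X) : (cong P X)ᵀ = - cong P X := by
  simp [cong_apply, Matrix.transpose_mul, h, Matrix.mul_assoc]

/-- The span of the matrices with the given codes. -/
def spanL (U : List ℕ) : Submodule (ZMod 3) M55 :=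
  Submodule.span (ZMod 3) ((fun u => asM (digs u)) '' {u | u ∈ U})

lemma mem_spanL {U : List ℕ} {u : ℕ} (h : u ∈ U) : asM (digs u) ∈ spanL U :=
  Submodule.subset_span ⟨u, h, rfl⟩

lemma spanL_le {U : List ℕ} {V : Submodule (ZMod 3) M55} :
    spanL U ≤ V ↔ ∀ u ∈ U, asM (digs u) ∈ V := by
  rw [spanL, Submodule.span_le]
  constructor
  · intro h u hu
    exact h ⟨u, hu, rfl⟩
  · rintro h _ ⟨u, hu, rfl⟩
    exact h u hu

lemma spanL_mono {U W : List ℕ} (h : ∀ u ∈ U, u ∈ W) : spanL U ≤ spanL W :=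
  spanL_le.2 fun u hu => mem_spanL (h u hu)

lemma finrank_spanL (U : List ℕ) : Module.finrank (ZMod 3) (spanL U) ≤ U.length := by
  classical
  have : ((fun u => asM (digs u)) '' {u | u ∈ U}) =
      ((U.toFinset.image (fun u => asM (digs u)) : Finset M55) : Set M55) := by
    ext X; simp
  rw [spanL, this]
  refine (finrank_span_finset_le_card _).trans ?_
  exact Finset.card_image_le.trans (List.toFinset_card_le U)

def addL (k : ℕ) (y u : List ℕ) : List ℕ := List.zipWith (fun a b => a + k * b) y u

lemma asM_addL (k : ℕ) (y u : List ℕ) (hy : y.length = 10) (hu : u.length = 10) :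
    asM (addL k y u) = asM y + (k : ZMod 3) • asM u := by
  obtain ⟨y0, y1, y2, y3, y4, y5, y6, y7, y8, y9, rfl⟩ := exists_list10 y hy
  obtain ⟨u0, u1, u2, u3, u4, u5, u6, u7, u8, u9, rfl⟩ := exists_list10 u hu
  ext i j
  fin_cases i <;> fin_cases j <;> simp [asM, addL] <;> ring

def inSpan : List ℕ → List ℕ → Bool
  | [], y => y.all fun a => a % 3 == 0
  | u :: U, y => inSpan U y || inSpan U (addL 1 y (digs u)) || inSpan U (addL 2 y (digs u))

lemma asM_zero (y : List ℕ) (h : ∀ a ∈ y, a % 3 = 0) : asM y = 0 := by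
  have h' : ∀ k, ((y.getD k 0 : ℕ) : ZMod 3) = 0 := by
    intro k
    rw [ZMod.natCast_eq_zero_iff]
    by_cases hk : k < y.length
    · rw [List.getD_eq_getElem _ _ hk]
      exact Nat.dvd_of_mod_eq_zero (h _ (List.getElem_mem hk))
    · rw [List.getD_eq_default _ _ (by omega)]; simp
  ext i j
  simp only [asM, h']
  fin_cases i <;> fin_cases j <;> simp

lemma inSpan_sound (U y : List ℕ) (hy : y.length = 10) (h : inSpan U y = true) :
    asM y ∈ spanL U := by
  induction U generalizing y with
  | nil =>
    simp only [inSpan, List.all_eq_true, beq_iff_eq] at h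
    rw [asM_zero y h]
    exact Submodule.zero_mem _
  | cons u U ih =>
    have hm : spanL U ≤ spanL (u :: U) := spanL_mono fun a ha => List.mem_cons_of_mem _ ha
    have hu : asM (digs u) ∈ spanL (u :: U) := mem_spanL List.mem_cons_self
    have hl : ∀ k, (addL k y (digs u)).length = 10 := by
      intro k; simp [addL, hy, digs_length]
    have hk : ∀ k, inSpan U (addL k y (digs u)) = true → asM y ∈ spanL (u :: U) := by
      intro k hk
      have := hm (ih _ (hl k) hk)
      rw [asM_addL k y _ hy (digs_length u)] at this
      exact (Submodule.add_mem_iff_left _ (Submodule.smul_mem _ _ hu)).1 this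
    simp only [inSpan, Bool.or_eq_true] at h
    rcases h with (h | h) | h
    · exact hm (ih y hy h)
    · exact hk 1 h
    · exact hk 2 h

/-- `P * Q = 1` on codes. -/
def invOK (P Q : ℕ) : Bool :=
  (List.range 5).all fun i => (List.range 5).all fun j =>
    (ent P i 0 * ent Q 0 j + ent P i 1 * ent Q 1 j + ent P i 2 * ent Q 2 j + ent P i 3 * ent Q 3 j
      + ent P i 4 * ent Q 4 j) % 3 == if i = j then 1 else 0

lemma invOK_sound {P Q : ℕ} (h : invOK P Q = true) : matP P * matP Q = 1 := by
  simp only [invOK, List.all_eq_true, List.mem_range, beq_iff_eq] at h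
  ext i j
  have := congrArg (fun n : ℕ => (n : ZMod 3)) (h i i.2 j j.2)
  simp only [ZMod.natCast_mod] at this
  rw [Matrix.mul_apply, Fin.sum_univ_five, Matrix.one_apply]
  simp only [matP, Matrix.of_apply]
  push_cast at this
  rw [show ((if (i : ℕ) = (j : ℕ) then (1 : ZMod 3) else 0)) = if i = j then 1 else 0 by
    simp [Fin.ext_iff]] at this
  exact this

/-- The codes of `repCodes` give the representatives. -/
def Hit (reps : List (List ℕ)) (V : Submodule (ZMod 3) M55) : Prop :=
  ∃ r ∈ reps, ∃ P Q : M55, P * Q = 1 ∧ Q * P = 1 ∧ spanL r = V.map (cong P)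

lemma Hit_of_map {reps : List (List ℕ)} {V : Submodule (ZMod 3) M55} {P Q : M55}
    (h1 : P * Q = 1) (h2 : Q * P = 1) (h : Hit reps (V.map (cong P))) : Hit reps V := by
  obtain ⟨r, hr, A, B, hA, hB, e⟩ := h
  refine ⟨r, hr, A * P, Q * B, ?_, ?_, ?_⟩
  · rw [Matrix.mul_assoc, ← Matrix.mul_assoc P, h1, Matrix.one_mul, hA]
  · rw [Matrix.mul_assoc, ← Matrix.mul_assoc B, hB, Matrix.one_mul, h2]
  · rw [e, ← Submodule.map_comp]
    congr 1
    ext1 X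
    simp [cong_apply, Matrix.transpose_mul, Matrix.mul_assoc]

/-- Every 3-dimensional antisymmetric space containing the codes `U` and `x`, with `x` outside the
span of `U`, is congruent to a representative. -/
def Good (reps : List (List ℕ)) (U : List ℕ) (x : List ℕ) : Prop :=
  ∀ V : Submodule (ZMod 3) M55, (∀ X ∈ V, Xᵀ = -X) → Module.finrank (ZMod 3) V = 3 →
    spanL U ≤ V → asM x ∈ V → asM x ∉ spanL U → Hit reps V

lemma finrank_map_cong {P Q : M55} (h : Q * P = 1) (V : Submodule (ZMod 3) M55) :
    Module.finrank (ZMod 3) (V.map (cong P)) = Module.finrank (ZMod 3) V :=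
  (Submodule.equivMapOfInjective (cong P) (cong_inj h) V).finrank_eq.symm

lemma map_anti (P : M55) {V : Submodule (ZMod 3) M55} (h : ∀ X ∈ V, Xᵀ = -X) :
    ∀ X ∈ V.map (cong P), Xᵀ = -X := by
  rintro _ ⟨X, hX, rfl⟩
  exact cong_anti P X (h X hX)

/-- Congruence moves. -/
lemma good_cong {reps : List (List ℕ)} {U : List ℕ} {x : List ℕ} (hx : x.length = 10) {P Q : ℕ}
    (hi : invOK P Q = true) (hU : (U.all fun u => inSpan U (act (lam P) (digs u))) = true)
    (h : Good reps U (act (lam P) x)) : Good reps U x := by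
  intro V hV hf hUV hxV hxU
  have h1 := invOK_sound hi
  have h2 : matP Q * matP P = 1 := mul_eq_one_comm.1 h1
  have hle : (spanL U).map (cong (matP P)) ≤ spanL U := by
    rw [Submodule.map_le_iff_le_comap, spanL_le]
    intro u hu
    rw [Submodule.mem_comap, cong_apply, ← asM_act_lam _ _ (digs_length u)]
    exact inSpan_sound _ _ (act_lam_length _ _) (List.all_eq_true.1 hU u hu)
  have heq : (spanL U).map (cong (matP P)) = spanL U :=
    Submodule.eq_of_le_of_finrank_eq hle (finrank_map_cong h2 _)
  refine Hit_of_map h1 h2 (h _ (map_anti _ hV) ((finrank_map_cong h2 _).trans hf) ?_ ?_ ?_)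
  · rw [← heq]; exact Submodule.map_mono hUV
  · rw [asM_act_lam _ _ hx]
    exact ⟨_, hxV, rfl⟩
  · rw [asM_act_lam _ _ hx, ← heq]
    rintro ⟨Y, hY, e⟩
    rw [← cong_apply] at e
    exact hxU (cong_inj h2 e ▸ hY)

lemma good_neg {reps : List (List ℕ)} {U : List ℕ} {x : List ℕ} (hx : x.length = 10)
    (h : Good reps U (act negRows x)) : Good reps U x := by
  intro V hV hf hUV hxV hxU
  apply h V hV hf hUV
  · rw [asM_neg x hx]; exact V.neg_mem hxV
  · rw [asM_neg x hx]; rwa [Submodule.neg_mem_iff]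

lemma good_trans {reps : List (List ℕ)} {U : List ℕ} {x : List ℕ} (hx : x.length = 10)
    {u pv k : ℕ} (hp : pv < 10) (hu : u ∈ U)
    (h : Good reps U (act (transRows (digs u) pv k) x)) : Good reps U x := by
  intro V hV hf hUV hxV hxU
  have := mem_spanL hu
  apply h V hV hf hUV
  · rw [asM_trans _ x hx _ _ hp]
    exact V.add_mem hxV (V.smul_mem _ (hUV this))
  · rw [asM_trans _ x hx _ _ hp]
    rwa [Submodule.add_mem_iff_left _ (Submodule.smul_mem _ _ this)]

lemma hit_of_good {reps : List (List ℕ)} {W : List ℕ} (hW : W.length < 3)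
    (hsurj : ∀ y : List ℕ, y.length = 10 → (∀ a ∈ y, a < 3) → Good reps W y)
    {V' : Submodule (ZMod 3) M55} (hV' : ∀ X ∈ V', Xᵀ = -X)
    (hf' : Module.finrank (ZMod 3) V' = 3) (hWV : spanL W ≤ V') : Hit reps V' := by
  have : ¬ V' ≤ spanL W := by
    intro hle
    have := Submodule.finrank_mono hle
    have := finrank_spanL W
    omega
  obtain ⟨Y, hY, hYW⟩ := SetLike.not_le_iff_exists.1 this
  have hYa := hV' Y hY
  obtain ⟨y, hy, hy3, rfl⟩ : ∃ y : List ℕ, y.length = 10 ∧ (∀ a ∈ y, a < 3) ∧ asM y = Y := by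
    refine ⟨[(Y 0 1).val, (Y 0 2).val, (Y 0 3).val, (Y 0 4).val, (Y 1 2).val, (Y 1 3).val,
      (Y 1 4).val, (Y 2 3).val, (Y 2 4).val, (Y 3 4).val], rfl, ?_, ?_⟩
    · intro a ha
      simp only [List.mem_cons, List.not_mem_nil, or_false] at ha
      rcases ha with rfl | rfl | rfl | rfl | rfl | rfl | rfl | rfl | rfl | rfl <;>
        exact ZMod.val_lt _
    · have hij : ∀ i j, Y j i = - Y i j := fun i j => congrFun (congrFun hYa i) j
      have hii : ∀ i, Y i i = 0 := by
        intro i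
        have := hij i i
        generalize Y i i = a at *
        revert a; decide
      ext i j
      fin_cases i <;> fin_cases j <;> simp [asM, hii] <;> exact (hij _ _).symm
  exact hsurj y hy hy3 V' hV' hf' hWV hY hYW

/-- Passing to the next stage. -/
lemma good_next {reps : List (List ℕ)} {U W : List ℕ} {x : ℕ} (hW : W.length < 3)
    (hsurj : ∀ y : List ℕ, y.length = 10 → (∀ a ∈ y, a < 3) → Good reps W y) {P Q : ℕ}
    (hi : invOK P Q = true)
    (hc : (W.all fun w => inSpan (x :: U) (act (lam Q) (digs w))) = true) :
    Good reps U (digs x) := by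
  intro V hV hf hUV hxV hxU
  have h1 := invOK_sound hi
  have h2 : matP Q * matP P = 1 := mul_eq_one_comm.1 h1
  have hxUV : spanL (x :: U) ≤ V := by
    rw [spanL_le]
    intro u hu
    rcases List.mem_cons.1 hu with rfl | hu
    · exact hxV
    · exact hUV (mem_spanL hu)
  have hWV : spanL W ≤ V.map (cong (matP P)) := by
    rw [spanL_le]
    intro w hw
    refine ⟨cong (matP Q) (asM (digs w)), ?_, cong_cong h1 _⟩
    apply hxUV
    rw [cong_apply, ← asM_act_lam _ _ (digs_length w)]
    exact inSpan_sound _ _ (act_lam_length _ _) (List.all_eq_true.1 hc w hw)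
  apply Hit_of_map h1 h2
  have hf' := (finrank_map_cong h2 V).trans hf
  have hV' := map_anti (matP P) hV
  exact hit_of_good hW hsurj hV' hf' hWV

/-- Terminal spaces. -/
lemma good_term {reps : List (List ℕ)} {U r : List ℕ} {x : ℕ} (hr : r ∈ reps)
    (hr3 : Module.finrank (ZMod 3) (spanL r) = 3) {P Q : ℕ} (hi : invOK P Q = true)
    (hc : (r.all fun w => inSpan (x :: U) (act (lam Q) (digs w))) = true) :
    Good reps U (digs x) := by
  intro V hV hf hUV hxV hxU
  have h1 := invOK_sound hi
  have h2 : matP Q * matP P = 1 := mul_eq_one_comm.1 h1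
  have hxUV : spanL (x :: U) ≤ V := by
    rw [spanL_le]
    intro u hu
    rcases List.mem_cons.1 hu with rfl | hu
    · exact hxV
    · exact hUV (mem_spanL hu)
  refine ⟨r, hr, matP P, matP Q, h1, h2, ?_⟩
  apply Submodule.eq_of_le_of_finrank_eq
  · rw [spanL_le]
    intro w hw
    refine ⟨cong (matP Q) (asM (digs w)), ?_, cong_cong h1 _⟩
    apply hxUV
    rw [cong_apply, ← asM_act_lam _ _ (digs_length w)]
    exact inSpan_sound _ _ (act_lam_length _ _) (List.all_eq_true.1 hc w hw)
  · rw [hr3, finrank_map_cong h2, hf]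

lemma good_zero {reps : List (List ℕ)} {U : List ℕ} {x : List ℕ} (h : ∀ a ∈ x, a % 3 = 0) :
    Good reps U x := by
  intro V hV hf hUV hxV hxU
  rw [asM_zero x h] at hxU
  exact absurd (Submodule.zero_mem _) hxU

/-- The moves used for reducing a code modulo `U`. -/
inductive Mv
  | cg (P Q : ℕ)
  | ng
  | tr (u pv k : ℕ)

def Mv.rows : Mv → List (List ℕ)
  | .cg P _ => lam P
  | .ng => negRows
  | .tr u pv k => transRows (digs u) pv k

def Mv.ok (U : List ℕ) : Mv → Bool
  | .cg P Q => invOK P Q && U.all fun u => inSpan U (act (lam P) (digs u))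
  | .ng => true
  | .tr u pv _ => decide (pv < 10) && U.contains u

lemma Mv.rows_length (m : Mv) : m.rows.length = 10 := by
  cases m <;> simp [Mv.rows, lam, prs, negRows, transRows]

lemma Mv.good {reps : List (List ℕ)} {U : List ℕ} {x : List ℕ} (hx : x.length = 10) (m : Mv)
    (hm : m.ok U = true) (h : Good reps U (act m.rows x)) : Good reps U x := by
  cases m with
  | cg P Q =>
    simp only [Mv.ok, Bool.and_eq_true] at hm
    exact good_cong hx hm.1 hm.2 h
  | ng => exact good_neg hx h
  | tr u pv k =>
    simp only [Mv.ok, Bool.and_eq_true, decide_eq_true_eq, List.contains_iff_mem] at hm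
    exact good_trans hx hm.1 hm.2 h

/-- Base three value, most significant digit first. -/
def val : List ℕ → ℕ
  | [] => 0
  | d :: ds => d * 3 ^ ds.length + val ds

lemma val_lt (l : List ℕ) (h : ∀ a ∈ l, a < 3) : val l < 3 ^ l.length := by
  induction l with
  | nil => simp [val]
  | cons d ds ih =>
    have := ih fun a ha => h a (List.mem_cons_of_mem _ ha)
    have := h d List.mem_cons_self
    simp only [val, List.length_cons, pow_succ]
    nlinarith [Nat.pow_pos (n := ds.length) (show 0 < 3 by norm_num)]

/-- The move with rows `rs` makes every code starting with `p` smaller. -/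
def kills (p : List ℕ) : List (List ℕ) → List ℕ → Bool
  | r :: rs, d :: ds => Nat.ble r.length p.length &&
      (Nat.blt (dot r p % 3) d || (Nat.beq (dot r p % 3) d && kills p rs ds))
  | _, _ => false

lemma dot_append (r p y : List ℕ) (h : r.length ≤ p.length) : dot r (p ++ y) = dot r p := by
  induction r generalizing p with
  | nil => cases p <;> cases y <;> rfl
  | cons a as ih =>
    cases p with
    | nil => simp at h
    | cons b bs =>
      simp only [List.cons_append, dot]
      rw [ih bs (by simpa using h)]

lemma kills_sound (p y : List ℕ) (rs : List (List ℕ)) (ds : List ℕ)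
    (hl : rs.length = (ds ++ y).length) (h : kills p rs ds = true) :
    val (act rs (p ++ y)) < val (ds ++ y) := by
  induction rs generalizing ds with
  | nil => simp [kills] at h
  | cons r rs ih =>
    cases ds with
    | nil => simp [kills] at h
    | cons d ds =>
      simp only [kills, Bool.and_eq_true, Bool.or_eq_true, Nat.ble_eq] at h
      obtain ⟨h0, h⟩ := h
      have hl' : rs.length = (ds ++ y).length := by simpa using hl
      have e : act (r :: rs) (p ++ y) = dot r p % 3 :: act rs (p ++ y) := by
        simp [act, dot_append r p y h0]
      have el : (act rs (p ++ y)).length = (ds ++ y).length := by simp only [act, List.length_map, hl']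
      have hv : val (act rs (p ++ y)) < 3 ^ (ds ++ y).length := by
        rw [← el]
        apply val_lt
        intro a ha
        simp only [act, List.mem_map] at ha
        obtain ⟨r, -, rfl⟩ := ha
        exact Nat.mod_lt _ (by norm_num)
      rw [e, List.cons_append]
      simp only [val, el]
      rcases h with h | ⟨h1, h2⟩
      · have h : dot r p % 3 < d := by simpa [Nat.blt_eq] using h
        have : (dot r p % 3 + 1) * 3 ^ (ds ++ y).length ≤ d * 3 ^ (ds ++ y).length :=
          Nat.mul_le_mul_right _ h
        nlinarith
      · rw [Nat.eq_of_beq_eq_true h1]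
        have := ih ds hl' h2
        omega

/-- Depth first search through all codes: everything but the terminal codes is reduced. -/
def chk (ms : List (List (List ℕ))) (ts : List (List ℕ)) : ℕ → List ℕ → Bool
  | 0, p => (ms.any fun m => kills p m p) || ts.contains p
  | n + 1, p => (ms.any fun m => kills p m p) ||
      (chk ms ts n (p ++ [0]) && (chk ms ts n (p ++ [1]) && chk ms ts n (p ++ [2])))

lemma chk_sound (ms : List (List (List ℕ))) (ts : List (List ℕ)) (hms : ∀ m ∈ ms, m.length = 10)
    (n : ℕ) (p : List ℕ) (hp : p.length + n = 10) (h : chk ms ts n p = true) (y : List ℕ)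
    (hy : y.length = n) (hy3 : ∀ a ∈ y, a < 3) :
    p ++ y ∈ ts ∨ ∃ m ∈ ms, val (act m (p ++ y)) < val (p ++ y) := by
  have hk : ∀ n (y : List ℕ), y.length = n → p.length + n = 10 →
      (ms.any fun m => kills p m p) = true → ∃ m ∈ ms, val (act m (p ++ y)) < val (p ++ y) := by
    intro n y hy hp h
    obtain ⟨m, hm, h⟩ := List.any_eq_true.1 h
    exact ⟨m, hm, kills_sound p y m p (by rw [hms m hm]; simp; omega) h⟩
  induction n generalizing p y with
  | zero =>
    simp only [chk, Bool.or_eq_true] at h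
    rcases h with h | h
    · exact Or.inr (hk 0 y hy hp h)
    · rw [List.length_eq_zero_iff.1 hy, List.append_nil]
      exact Or.inl (List.contains_iff_mem.1 h)
  | succ n ih =>
    simp only [chk, Bool.or_eq_true, Bool.and_eq_true] at h
    rcases h with h | ⟨h0, h1, h2⟩
    · exact Or.inr (hk _ y hy hp h)
    · cases y with
      | nil => simp at hy
      | cons a y =>
        have hk' : ∀ b, ∀ n (y : List ℕ), y.length = n → (p ++ [b]).length + n = 10 →
            (ms.any fun m => kills (p ++ [b]) m (p ++ [b])) = true →
            ∃ m ∈ ms, val (act m (p ++ [b] ++ y)) < val (p ++ [b] ++ y) := by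
          intro b n y hy hp h
          obtain ⟨m, hm, h⟩ := List.any_eq_true.1 h
          exact ⟨m, hm, kills_sound _ y m _ (by rw [hms m hm]; simp at hp ⊢; omega) h⟩
        have ha := hy3 a List.mem_cons_self
        have key : ∀ b, chk ms ts n (p ++ [b]) = true → a = b →
            p ++ a :: y ∈ ts ∨ ∃ m ∈ ms, val (act m (p ++ a :: y)) < val (p ++ a :: y) := by
          rintro b hb rfl
          have := ih (p ++ [a]) (by simp; omega) hb y (by simpa using hy)
            (fun c hc => hy3 c (List.mem_cons_of_mem _ hc)) (hk' a)
          simpa using this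
        have : a = 0 ∨ a = 1 ∨ a = 2 := by omega
        rcases this with e | e | e
        · exact key 0 h0 e
        · exact key 1 h1 e
        · exact key 2 h2 e

/-- The main reduction. -/
theorem stage {reps : List (List ℕ)} {U : List ℕ} (ms : List Mv) (ts : List ℕ)
    (hok : (ms.all fun m => m.ok U) = true)
    (hchk : chk (ms.map Mv.rows) (ts.map digs) 10 [] = true)
    (hts : ∀ t ∈ ts, Good reps U (digs t)) (x : List ℕ) (hx : x.length = 10)
    (hx3 : ∀ a ∈ x, a < 3) : Good reps U x := by
  induction hv : val x using Nat.strong_induction_on generalizing x with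
  | _ v ih =>
    have hl : ∀ m ∈ ms.map Mv.rows, m.length = 10 := by
      intro m hm
      obtain ⟨m, -, rfl⟩ := List.mem_map.1 hm
      exact m.rows_length
    rcases chk_sound _ _ hl 10 [] (by simp) hchk x hx hx3 with h | ⟨m, hm, h⟩
    · obtain ⟨t, ht, e⟩ := List.mem_map.1 h
      rw [List.nil_append] at e
      exact e ▸ hts t ht
    · obtain ⟨m, hm', rfl⟩ := List.mem_map.1 hm
      rw [List.nil_append] at h
      apply m.good hx (List.all_eq_true.1 hok m hm')
      refine ih _ (hv ▸ h) _ ?_ ?_ rfl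
      · simp [act, m.rows_length]
      · intro a ha
        simp only [act, List.mem_map] at ha
        obtain ⟨r, -, rfl⟩ := ha
        exact Nat.mod_lt _ (by norm_num)

/-- Certificates for terminal codes: `(t, i, P, Q)`. -/
def certOK (Ws : List (List ℕ)) (U : List ℕ) (c : ℕ × ℕ × ℕ × ℕ) : Bool :=
  invOK c.2.2.1 c.2.2.2 && ((Ws.getD c.2.1 []).all fun w =>
    inSpan (c.1 :: U) (act (lam c.2.2.2) (digs w)))

theorem stage_next {reps Ws : List (List ℕ)} {U : List ℕ} (ms : List Mv)
    (cs : List (ℕ × ℕ × ℕ × ℕ))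
    (hok : (ms.all fun m => m.ok U) = true)
    (hchk : chk (ms.map Mv.rows) ((0 :: cs.map Prod.fst).map digs) 10 [] = true)
    (hcs : (cs.all fun c => decide (c.2.1 < Ws.length) && certOK Ws U c) = true)
    (hW : ∀ W ∈ Ws, W.length < 3 ∧
      ∀ y : List ℕ, y.length = 10 → (∀ a ∈ y, a < 3) → Good reps W y)
    (x : List ℕ) (hx : x.length = 10) (hx3 : ∀ a ∈ x, a < 3) : Good reps U x := by
  refine stage ms _ hok hchk ?_ x hx hx3
  intro t ht
  rcases List.mem_cons.1 ht with rfl | ht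
  · exact good_zero (by decide)
  · obtain ⟨c, hc, rfl⟩ := List.mem_map.1 ht
    have := List.all_eq_true.1 hcs c hc
    rw [certOK, Bool.and_eq_true, Bool.and_eq_true, decide_eq_true_eq] at this
    have hm : Ws.getD c.2.1 [] ∈ Ws := by
      rw [List.getD_eq_getElem _ _ this.1]
      exact List.getElem_mem _
    exact good_next (hW _ hm).1 (hW _ hm).2 this.2.1 this.2.2

theorem stage_last {reps : List (List ℕ)} {U : List ℕ} (ms : List Mv)
    (cs : List (ℕ × ℕ × ℕ × ℕ))
    (hok : (ms.all fun m => m.ok U) = true)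
    (hchk : chk (ms.map Mv.rows) ((0 :: cs.map Prod.fst).map digs) 10 [] = true)
    (hcs : (cs.all fun c => decide (c.2.1 < reps.length) && certOK reps U c) = true)
    (hr : ∀ r ∈ reps, Module.finrank (ZMod 3) (spanL r) = 3)
    (x : List ℕ) (hx : x.length = 10) (hx3 : ∀ a ∈ x, a < 3) : Good reps U x := by
  refine stage ms _ hok hchk ?_ x hx hx3
  intro t ht
  rcases List.mem_cons.1 ht with rfl | ht
  · exact good_zero (by decide)
  · obtain ⟨c, hc, rfl⟩ := List.mem_map.1 ht
    have := List.all_eq_true.1 hcs c hc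
    rw [certOK, Bool.and_eq_true, Bool.and_eq_true, decide_eq_true_eq] at this
    have hm : reps.getD c.2.1 [] ∈ reps := by
      rw [List.getD_eq_getElem _ _ this.1]
      exact List.getElem_mem _
    exact good_term hm (hr _ hm) this.2.1 this.2.2

def vecs : ℕ → List (List ℕ)
  | 0 => [[]]
  | n + 1 => (vecs n).flatMap fun l => [0 :: l, 1 :: l, 2 :: l]

lemma mem_vecs {n : ℕ} {l : List ℕ} : l ∈ vecs n ↔ l.length = n ∧ ∀ a ∈ l, a < 3 := by
  induction n generalizing l with
  | zero =>
    simp only [vecs, List.mem_singleton, List.length_eq_zero_iff]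
    constructor
    · rintro rfl; simp
    · exact fun h => h.1
  | succ n ih =>
    simp only [vecs, List.mem_flatMap, List.mem_cons, List.not_mem_nil, or_false]
    constructor
    · rintro ⟨l', h', rfl | rfl | rfl⟩ <;>
      · have := ih.1 h'
        refine ⟨by simp [this.1], ?_⟩
        intro a ha
        rcases List.mem_cons.1 ha with rfl | ha
        · norm_num
        · exact this.2 a ha
    · rintro ⟨h1, h2⟩
      cases l with
      | nil => simp at h1
      | cons a l =>
        refine ⟨l, ih.2 ⟨by simpa using h1, fun b hb => h2 b (List.mem_cons_of_mem _ hb)⟩, ?_⟩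
        have := h2 a List.mem_cons_self
        have : a = 0 ∨ a = 1 ∨ a = 2 := by omega
        rcases this with rfl | rfl | rfl <;> simp

lemma nodup_vecs (n : ℕ) : (vecs n).Nodup := by
  induction n with
  | zero => simp [vecs]
  | succ n ih =>
    rw [vecs, List.nodup_flatMap]
    refine ⟨fun l _ => by simp, ?_⟩
    refine ih.imp ?_
    intro a b hab
    simp [Function.onFun, List.Disjoint, hab]

def toV (n : ℕ) (l : List ℕ) : Fin n → ZMod 3 := fun i => ((l.getD i 0 : ℕ) : ZMod 3)

lemma toV_inj {n : ℕ} {l l' : List ℕ} (h : l ∈ vecs n) (h' : l' ∈ vecs n)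
    (e : toV n l = toV n l') : l = l' := by
  rw [mem_vecs] at h h'
  apply List.ext_getElem (h.1.trans h'.1.symm)
  intro i hi hi'
  have := congrFun e ⟨i, h.1 ▸ hi⟩
  simp only [toV, List.getD_eq_getElem _ _ hi, List.getD_eq_getElem _ _ hi'] at this
  have e := (ZMod.natCast_eq_natCast_iff' _ _ _).1 this
  rwa [Nat.mod_eq_of_lt (h.2 _ (List.getElem_mem _)),
    Nat.mod_eq_of_lt (h'.2 _ (List.getElem_mem _))] at e

lemma exists_vecs {n : ℕ} (v : Fin n → ZMod 3) : ∃ l ∈ vecs n, toV n l = v := by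
  refine ⟨List.ofFn fun i => (v i).val, ?_, ?_⟩
  · rw [mem_vecs]
    refine ⟨by simp, ?_⟩
    intro a ha
    obtain ⟨i, rfl⟩ := (List.mem_ofFn).1 ha
    exact ZMod.val_lt _
  · ext i
    simp [toV]

lemma sum_vecs {n : ℕ} (f : (Fin n → ZMod 3) → ℕ) :
    ∑ v, f v = ((vecs n).map fun l => f (toV n l)).sum := by
  classical
  have hu : (Finset.univ : Finset (Fin n → ZMod 3)) = ((vecs n).toFinset).image (toV n) := by
    ext v
    obtain ⟨l, hl, e⟩ := exists_vecs v
    simp only [Finset.mem_univ, Finset.mem_image, List.mem_toFinset, true_iff]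
    exact ⟨l, hl, e⟩
  rw [hu, Finset.sum_image, List.sum_toFinset _ (nodup_vecs n)]
  intro a ha b hb e
  exact toV_inj (by simpa using ha) (by simpa using hb) e

lemma card_vecs {n : ℕ} (P : (Fin n → ZMod 3) → Prop) (f : List ℕ → Bool)
    (h : ∀ l ∈ vecs n, P (toV n l) ↔ f l = true) :
    Nat.card {v // P v} = (vecs n).countP f := by
  classical
  rw [Nat.card_eq_fintype_card, Fintype.card_subtype, Finset.card_filter, sum_vecs]
  generalize vecs n = L at h
  induction L with
  | nil => rfl
  | cons a L ih =>
    rw [List.map_cons, List.sum_cons, ih fun l hl => h l (List.mem_cons_of_mem _ hl),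
      List.countP_cons, add_comm]
    simp [h a List.mem_cons_self]

lemma sum_filter_list (L : List (List ℕ)) (p : List ℕ → Bool) (f : List ℕ → ℕ) :
    (L.map fun l => if p l = true then f l else 0).sum = ((L.filter p).map f).sum := by
  induction L with
  | nil => rfl
  | cons a L ih =>
    by_cases h : p a = true
    · simp [h, ih]
    · simp [h, ih]

/-! ### Invariants -/

/-- Number of elements of `V` killing `v`. -/
noncomputable def nv (V : Submodule (ZMod 3) M55) (v : Fin 5 → ZMod 3) : ℕ :=
  Nat.card {X : M55 // X ∈ V ∧ X *ᵥ v = 0}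

/-- `u` and `v` are orthogonal for all forms in `V`. -/
def orth (V : Submodule (ZMod 3) M55) (u v : Fin 5 → ZMod 3) : Prop :=
  ∀ X ∈ V, u ⬝ᵥ (X *ᵥ v) = 0

noncomputable def invH (V : Submodule (ZMod 3) M55) : ℕ := ∑ v, nv V v ^ 4

open Classical in
noncomputable def invG (k : ℕ) (V : Submodule (ZMod 3) M55) : ℕ :=
  ∑ u, if nv V u = k then (∑ v, if nv V v = k then (if orth V u v then 1 else 0) else 0) else 0

lemma cong_mulVec (P X : M55) (v : Fin 5 → ZMod 3) : cong P X *ᵥ v = P *ᵥ (X *ᵥ (Pᵀ *ᵥ v)) := by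
  simp [cong_apply, Matrix.mulVec_mulVec, Matrix.mul_assoc]

lemma nv_map {P Q : M55} (h2 : Q * P = 1) (V : Submodule (ZMod 3) M55)
    (v : Fin 5 → ZMod 3) : nv (V.map (cong P)) v = nv V (Pᵀ *ᵥ v) := by
  symm
  refine Nat.card_congr (Equiv.ofBijective
    (fun X => ⟨cong P X.1, ⟨X.1, X.2.1, rfl⟩, ?_⟩) ⟨?_, ?_⟩)
  · rw [cong_mulVec, X.2.2, Matrix.mulVec_zero]
  · intro X Y h
    exact Subtype.ext (cong_inj h2 (congrArg Subtype.val h))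
  · rintro ⟨_, ⟨X, hX, rfl⟩, h⟩
    refine ⟨⟨X, hX, ?_⟩, rfl⟩
    rw [cong_mulVec] at h
    have := congrArg (fun w => Q *ᵥ w) h
    simpa [Matrix.mulVec_mulVec, h2, ← Matrix.mul_assoc] using this

lemma orth_map (P : M55) (V : Submodule (ZMod 3) M55)
    (u v : Fin 5 → ZMod 3) : orth (V.map (cong P)) u v ↔ orth V (Pᵀ *ᵥ u) (Pᵀ *ᵥ v) := by
  have key : ∀ X, u ⬝ᵥ (cong P X *ᵥ v) = (Pᵀ *ᵥ u) ⬝ᵥ (X *ᵥ (Pᵀ *ᵥ v)) := by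
    intro X
    rw [cong_mulVec, Matrix.dotProduct_mulVec, Matrix.mulVec_transpose P u]
  constructor
  · intro h X hX
    rw [← key]
    exact h _ ⟨X, hX, rfl⟩
  · rintro h _ ⟨X, hX, rfl⟩
    rw [key]
    exact h X hX

/-- The bijection of vectors given by `Pᵀ`. -/
def vecEquiv {P Q : M55} (h1 : P * Q = 1) (h2 : Q * P = 1) :
    (Fin 5 → ZMod 3) ≃ (Fin 5 → ZMod 3) where
  toFun v := Pᵀ *ᵥ v
  invFun v := Qᵀ *ᵥ v
  left_inv v := by
    show Qᵀ *ᵥ (Pᵀ *ᵥ v) = v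
    rw [Matrix.mulVec_mulVec, ← Matrix.transpose_mul, h1, Matrix.transpose_one, Matrix.one_mulVec]
  right_inv v := by
    show Pᵀ *ᵥ (Qᵀ *ᵥ v) = v
    rw [Matrix.mulVec_mulVec, ← Matrix.transpose_mul, h2, Matrix.transpose_one, Matrix.one_mulVec]

lemma vecEquiv_apply {P Q : M55} (h1 : P * Q = 1) (h2 : Q * P = 1) (v : Fin 5 → ZMod 3) :
    vecEquiv h1 h2 v = Pᵀ *ᵥ v := rfl

lemma invH_map {P Q : M55} (h1 : P * Q = 1) (h2 : Q * P = 1) (V : Submodule (ZMod 3) M55) :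
    invH (V.map (cong P)) = invH V := by
  unfold invH
  rw [← Equiv.sum_comp (vecEquiv h1 h2) (fun v => nv V v ^ 4)]
  exact Finset.sum_congr rfl fun v _ => by rw [nv_map h2, vecEquiv_apply]

open Classical in
lemma invG_map {P Q : M55} (h1 : P * Q = 1) (h2 : Q * P = 1) (k : ℕ)
    (V : Submodule (ZMod 3) M55) : invG k (V.map (cong P)) = invG k V := by
  have hin : ∀ u, (∑ v, if nv V v = k then (if orth V (Pᵀ *ᵥ u) v then 1 else 0) else 0) =
      ∑ v, if nv (V.map (cong P)) v = k then
        (if orth (V.map (cong P)) u v then 1 else 0) else 0 := by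
    intro u
    rw [← Equiv.sum_comp (vecEquiv h1 h2)
      (fun v => if nv V v = k then (if orth V (Pᵀ *ᵥ u) v then 1 else 0) else 0)]
    refine Finset.sum_congr rfl fun v _ => ?_
    rw [nv_map h2, vecEquiv_apply]
    simp only [orth_map]
  unfold invG
  rw [← Equiv.sum_comp (vecEquiv h1 h2) (fun u => if nv V u = k then
    (∑ v, if nv V v = k then (if orth V u v then 1 else 0) else 0) else 0)]
  refine Finset.sum_congr rfl fun u _ => ?_
  rw [nv_map h2, vecEquiv_apply, hin u]

lemma rad_map {P Q : M55} (h1 : P * Q = 1) (h2 : Q * P = 1) (V : Submodule (ZMod 3) M55)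
    (h : radOf V = {0}) : radOf (V.map (cong P)) = {0} := by
  ext v
  simp only [radOf, Set.mem_ofPred_eq, Set.mem_singleton_iff]
  constructor
  · intro hv
    have : Pᵀ *ᵥ v ∈ radOf V := by
      intro X hX
      have := hv _ ⟨X, hX, rfl⟩
      rw [cong_mulVec] at this
      have := congrArg (fun w => Q *ᵥ w) this
      simpa [Matrix.mulVec_mulVec, h2, ← Matrix.mul_assoc] using this
    rw [h, Set.mem_singleton_iff] at this
    have := congrArg (fun w => Qᵀ *ᵥ w) this
    simpa [Matrix.mulVec_mulVec, ← Matrix.transpose_mul, h1] using this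
  · rintro rfl
    intro X _
    exact Matrix.mulVec_zero _

/-! ### Evaluation -/

/-- The linear combinations of the three given matrices. -/
def comb (A B C : M55) : (Fin 3 → ZMod 3) →ₗ[ZMod 3] M55 where
  toFun x := x 0 • A + x 1 • B + x 2 • C
  map_add' x y := by simp only [Pi.add_apply, add_smul]; abel
  map_smul' a x := by simp [mul_smul, smul_add]

lemma comb_apply (A B C : M55) (x : Fin 3 → ZMod 3) :
    comb A B C x = x 0 • A + x 1 • B + x 2 • C := rfl

lemma spanL_eq_range (a b c : ℕ) :
    spanL [a, b, c] = LinearMap.range (comb (asM (digs a)) (asM (digs b)) (asM (digs c))) := by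
  apply le_antisymm
  · rw [spanL_le]
    intro u hu
    simp only [List.mem_cons, List.not_mem_nil, or_false] at hu
    rcases hu with rfl | rfl | rfl
    · exact ⟨![1, 0, 0], by simp [comb_apply]⟩
    · exact ⟨![0, 1, 0], by simp [comb_apply]⟩
    · exact ⟨![0, 0, 1], by simp [comb_apply]⟩
  · rintro _ ⟨x, rfl⟩
    rw [comb_apply]
    exact Submodule.add_mem _ (Submodule.add_mem _ (Submodule.smul_mem _ _ (mem_spanL (by simp)))
      (Submodule.smul_mem _ _ (mem_spanL (by simp)))) (Submodule.smul_mem _ _ (mem_spanL (by simp)))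

/-- `x0 * a + x1 * b + x2 * c` is zero modulo three. -/
def combZ (x0 x1 x2 : ℕ) : List ℕ → List ℕ → List ℕ → Bool
  | a :: as, b :: bs, c :: cs =>
    Nat.beq ((x0 * a + x1 * b + x2 * c) % 3) 0 && combZ x0 x1 x2 as bs cs
  | _, _, _ => true

lemma combZ_iff (x0 x1 x2 : ℕ) (as bs cs : List ℕ) (n : ℕ) (ha : as.length = n)
    (hb : bs.length = n) (hc : cs.length = n) : combZ x0 x1 x2 as bs cs = true ↔
    (x0 : ZMod 3) • toV n as + (x1 : ZMod 3) • toV n bs + (x2 : ZMod 3) • toV n cs = 0 := by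
  induction n generalizing as bs cs with
  | zero =>
    rw [List.length_eq_zero_iff] at ha hb hc
    subst ha hb hc
    simp only [combZ, true_iff]
    exact Subsingleton.elim _ _
  | succ n ih =>
    cases as with
    | nil => simp at ha
    | cons a as =>
    cases bs with
    | nil => simp at hb
    | cons b bs =>
    cases cs with
    | nil => simp at hc
    | cons c cs =>
    simp only [combZ, Bool.and_eq_true]
    rw [ih as bs cs (by simpa using ha) (by simpa using hb) (by simpa using hc), funext_iff,
      funext_iff, Fin.forall_fin_succ]
    apply and_congr
    · rw [show Nat.beq ((x0 * a + x1 * b + x2 * c) % 3) 0 = true ↔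
        (x0 * a + x1 * b + x2 * c) % 3 = 0 from Nat.beq_eq ▸ Iff.rfl,
        ← Nat.dvd_iff_mod_eq_zero, ← ZMod.natCast_eq_zero_iff]
      simp [toV]
    · simp [toV]

def dot4 (a b c d w x y z : ℕ) : ℕ :=
  Nat.mod (Nat.add (Nat.add (Nat.add (Nat.mul a w) (Nat.mul b x)) (Nat.mul c y)) (Nat.mul d z))
    (nat_lit 3)

lemma dot4_cast (a b c d w x y z : ℕ) :
    (dot4 a b c d w x y z : ZMod 3) = a * w + b * x + c * y + d * z := by
  have : dot4 a b c d w x y z = (a * w + b * x + c * y + d * z) % 3 := rfl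
  rw [this, ZMod.natCast_mod]
  push_cast
  rfl

def mulL : List ℕ → List ℕ → List ℕ
  | [a, b, c, d, e, f, g, h, i, j], [v, w, x, y, z] =>
    [dot4 a b c d w x y z, dot4 a e f g (2 * v) x y z, dot4 b e h i (2 * v) (2 * w) y z,
      dot4 c f h j (2 * v) (2 * w) (2 * x) z, dot4 d g i j (2 * v) (2 * w) (2 * x) (2 * y)]
  | _, _ => []

lemma exists_list5 (x : List ℕ) (hx : x.length = 5) : ∃ a b c d e, x = [a, b, c, d, e] := by
  match x, hx with
  | [a, b, c, d, e], _ => exact ⟨a, b, c, d, e, rfl⟩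

lemma mulL_length (x v : List ℕ) (hx : x.length = 10) (hv : v.length = 5) :
    (mulL x v).length = 5 := by
  obtain ⟨x0, x1, x2, x3, x4, x5, x6, x7, x8, x9, rfl⟩ := exists_list10 x hx
  obtain ⟨a, b, c, d, e, rfl⟩ := exists_list5 v hv
  rfl

lemma asM_mulVec (x v : List ℕ) (hx : x.length = 10) (hv : v.length = 5) :
    asM x *ᵥ toV 5 v = toV 5 (mulL x v) := by
  obtain ⟨x0, x1, x2, x3, x4, x5, x6, x7, x8, x9, rfl⟩ := exists_list10 x hx
  obtain ⟨a, b, c, d, e, rfl⟩ := exists_list5 v hv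
  ext i
  fin_cases i <;> simp [Matrix.mulVec, dotProduct, Fin.sum_univ_five, asM, toV, mulL, dot4_cast, two_neg]

/-- Zero test for one coordinate. -/
def zt (x y z a b c : ℕ) : Bool :=
  Nat.beq (Nat.mod (Nat.add (Nat.add (Nat.mul x a) (Nat.mul y b)) (Nat.mul z c)) (nat_lit 3))
    (nat_lit 0)

def andN (a : Bool) (b : ℕ) : ℕ := Bool.rec (nat_lit 0) b a

def sum3 (f : ℕ → ℕ) : ℕ := Nat.add (Nat.add (f (nat_lit 0)) (f (nat_lit 1))) (f (nat_lit 2))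

/-- Counts the combinations of three vectors of length five which vanish. -/
def nvX : List ℕ → List ℕ → List ℕ → ℕ
  | [a0, a1, a2, a3, a4], [b0, b1, b2, b3, b4], [c0, c1, c2, c3, c4] =>
    sum3 fun z => sum3 fun y => sum3 fun x => andN (zt x y z a0 b0 c0) (andN (zt x y z a1 b1 c1)
      (andN (zt x y z a2 b2 c2) (andN (zt x y z a3 b3 c3) (andN (zt x y z a4 b4 c4) (nat_lit 1)))))
  | _, _, _ => 0

lemma sum3_eq (f : ℕ → ℕ) : sum3 f = f 0 + f 1 + f 2 := rfl

lemma andN_eq (x y z a0 a1 a2 a3 a4 b0 b1 b2 b3 b4 c0 c1 c2 c3 c4 : ℕ) :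
    andN (zt x y z a0 b0 c0) (andN (zt x y z a1 b1 c1) (andN (zt x y z a2 b2 c2)
      (andN (zt x y z a3 b3 c3) (andN (zt x y z a4 b4 c4) (nat_lit 1))))) =
    if combZ x y z [a0, a1, a2, a3, a4] [b0, b1, b2, b3, b4] [c0, c1, c2, c3, c4] = true
      then 1 else 0 := by
  have e : combZ x y z [a0, a1, a2, a3, a4] [b0, b1, b2, b3, b4] [c0, c1, c2, c3, c4] =
    (zt x y z a0 b0 c0 && (zt x y z a1 b1 c1 && (zt x y z a2 b2 c2 && (zt x y z a3 b3 c3 &&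
      (zt x y z a4 b4 c4 && true))))) := rfl
  rw [e]
  cases zt x y z a0 b0 c0 <;> cases zt x y z a1 b1 c1 <;> cases zt x y z a2 b2 c2 <;>
    cases zt x y z a3 b3 c3 <;> cases zt x y z a4 b4 c4 <;> rfl

lemma nvX_eq (A B C : List ℕ) (hA : A.length = 5) (hB : B.length = 5) (hC : C.length = 5) :
    nvX A B C = (vecs 3).countP fun x => combZ (x.getD 0 0) (x.getD 1 0) (x.getD 2 0) A B C := by
  obtain ⟨a0, a1, a2, a3, a4, rfl⟩ := exists_list5 A hA
  obtain ⟨b0, b1, b2, b3, b4, rfl⟩ := exists_list5 B hB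
  obtain ⟨c0, c1, c2, c3, c4, rfl⟩ := exists_list5 C hC
  simp only [nvX, andN_eq]
  generalize [a0, a1, a2, a3, a4] = A
  generalize [b0, b1, b2, b3, b4] = B
  generalize [c0, c1, c2, c3, c4] = C
  have e : vecs 3 = [[0, 0, 0], [1, 0, 0], [2, 0, 0], [0, 1, 0], [1, 1, 0], [2, 1, 0],
    [0, 2, 0], [1, 2, 0], [2, 2, 0], [0, 0, 1], [1, 0, 1], [2, 0, 1], [0, 1, 1], [1, 1, 1],
    [2, 1, 1], [0, 2, 1], [1, 2, 1], [2, 2, 1], [0, 0, 2], [1, 0, 2], [2, 0, 2], [0, 1, 2],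
    [1, 1, 2], [2, 1, 2], [0, 2, 2], [1, 2, 2], [2, 2, 2]] := by decide
  rw [e]
  simp only [sum3_eq, List.countP_cons, List.countP_nil, List.getD_cons_zero, List.getD_cons_succ]
  ring

/-- Counts the combinations killing `v`. -/
def nvL (A B C v : List ℕ) : ℕ := nvX (mulL A v) (mulL B v) (mulL C v)

def indL (A B C : List ℕ) : Bool :=
  (vecs 3).all fun x => (x.all fun a => Nat.beq a 0) ||
    !combZ (x.getD 0 0) (x.getD 1 0) (x.getD 2 0) A B C

lemma asM_eq_zero_iff (x : List ℕ) (hx : x.length = 10) : asM x = 0 ↔ toV 10 x = 0 := by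
  obtain ⟨x0, x1, x2, x3, x4, x5, x6, x7, x8, x9, rfl⟩ := exists_list10 x hx
  constructor
  · intro h
    have h' : ∀ i j, asM [x0, x1, x2, x3, x4, x5, x6, x7, x8, x9] i j = 0 := by
      intro i j; rw [h]; rfl
    ext i
    fin_cases i
    · exact h' 0 1
    · exact h' 0 2
    · exact h' 0 3
    · exact h' 0 4
    · exact h' 1 2
    · exact h' 1 3
    · exact h' 1 4
    · exact h' 2 3
    · exact h' 2 4
    · exact h' 3 4
  · intro h
    have h' : ∀ i, toV 10 [x0, x1, x2, x3, x4, x5, x6, x7, x8, x9] i = 0 := by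
      intro i; rw [h]; rfl
    apply asM_zero
    intro a ha
    obtain ⟨i, hi, rfl⟩ := List.getElem_of_mem ha
    have := h' ⟨i, hi⟩
    simp only [toV] at this
    rw [List.getD_eq_getElem _ _ hi, ZMod.natCast_eq_zero_iff] at this
    exact Nat.mod_eq_zero_of_dvd this

lemma comb_inj {A B C : List ℕ} (hA : A.length = 10) (hB : B.length = 10) (hC : C.length = 10)
    (h : indL A B C = true) : Function.Injective (comb (asM A) (asM B) (asM C)) := by
  rw [injective_iff_map_eq_zero]
  intro x hx
  obtain ⟨l, hl, rfl⟩ := exists_vecs x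
  have h := List.all_eq_true.1 h l hl
  rw [Bool.or_eq_true] at h
  rcases h with h | h
  · ext i
    have hall := List.all_eq_true.1 h
    have hi : (i : ℕ) < l.length := by rw [(mem_vecs.1 hl).1]; exact i.2
    have := Nat.eq_of_beq_eq_true (hall _ (List.getElem_mem hi))
    simp only [toV, Pi.zero_apply]
    rw [List.getD_eq_getElem _ _ hi, this]
    rfl
  · exfalso
    rw [Bool.not_eq_true', Bool.eq_false_iff] at h
    apply h
    rw [combZ_iff _ _ _ A B C 10 hA hB hC]
    have hl1 : (addL (l.getD 1 0) (addL (l.getD 0 0) (List.replicate 10 0) A) B).length = 10 := by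
      simp [addL, hA, hB]
    have hl0 : (addL (l.getD 0 0) (List.replicate 10 0) A).length = 10 := by
      simp [addL, hA]
    have e : asM (addL (l.getD 2 0) (addL (l.getD 1 0) (addL (l.getD 0 0) (List.replicate 10 0) A) B) C)
        = 0 := by
      rw [asM_addL _ _ _ hl1 hC, asM_addL _ _ _ hl0 hB, asM_addL _ _ _ (by simp) hA,
        asM_zero (List.replicate 10 0) (by simp), zero_add]
      exact hx
    rw [asM_eq_zero_iff _ (by simp [addL, hA, hB, hC])] at e
    rw [← e]
    obtain ⟨a0, a1, a2, a3, a4, a5, a6, a7, a8, a9, rfl⟩ := exists_list10 A hA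
    obtain ⟨b0, b1, b2, b3, b4, b5, b6, b7, b8, b9, rfl⟩ := exists_list10 B hB
    obtain ⟨c0, c1, c2, c3, c4, c5, c6, c7, c8, c9, rfl⟩ := exists_list10 C hC
    ext i
    fin_cases i <;> simp [toV, addL]

lemma comb_mulVec {A B C v : List ℕ} (hA : A.length = 10) (hB : B.length = 10)
    (hC : C.length = 10) (hv : v.length = 5) (l : List ℕ) :
    comb (asM A) (asM B) (asM C) (toV 3 l) *ᵥ toV 5 v = 0 ↔
      combZ (l.getD 0 0) (l.getD 1 0) (l.getD 2 0) (mulL A v) (mulL B v) (mulL C v) = true := by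
  rw [combZ_iff _ _ _ _ _ _ 5 (mulL_length _ _ hA hv) (mulL_length _ _ hB hv)
    (mulL_length _ _ hC hv), comb_apply, Matrix.add_mulVec, Matrix.add_mulVec,
    Matrix.smul_mulVec, Matrix.smul_mulVec, Matrix.smul_mulVec,
    asM_mulVec _ _ hA hv, asM_mulVec _ _ hB hv, asM_mulVec _ _ hC hv]
  rfl

lemma nv_eval {a b c : ℕ} (h : indL (digs a) (digs b) (digs c) = true) {v : List ℕ}
    (hv : v.length = 5) :
    nv (spanL [a, b, c]) (toV 5 v) = nvL (digs a) (digs b) (digs c) v := by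
  rw [nvL, nvX_eq _ _ _ (mulL_length _ _ (digs_length a) hv) (mulL_length _ _ (digs_length b) hv)
    (mulL_length _ _ (digs_length c) hv), ← card_vecs (n := 3) (fun x => comb (asM (digs a)) (asM (digs b)) (asM (digs c)) x *ᵥ
    toV 5 v = 0) _ (fun l _ => comb_mulVec (digs_length a) (digs_length b) (digs_length c) hv l)]
  symm
  refine Nat.card_congr (Equiv.ofBijective (fun x => ⟨comb _ _ _ x.1, ?_, x.2⟩) ⟨?_, ?_⟩)
  · rw [spanL_eq_range]; exact ⟨_, rfl⟩
  · intro x y e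
    exact Subtype.ext (comb_inj (digs_length a) (digs_length b) (digs_length c) h
      (congrArg Subtype.val e))
  · rintro ⟨X, hX, hXv⟩
    rw [spanL_eq_range] at hX
    obtain ⟨x, rfl⟩ := hX
    exact ⟨⟨x, hXv⟩, rfl⟩

lemma finrank_eval {a b c : ℕ} (h : indL (digs a) (digs b) (digs c) = true) :
    Module.finrank (ZMod 3) (spanL [a, b, c]) = 3 := by
  rw [spanL_eq_range, LinearMap.finrank_range_of_inj
    (comb_inj (digs_length a) (digs_length b) (digs_length c) h)]
  simp

lemma invH_eval {a b c : ℕ} (h : indL (digs a) (digs b) (digs c) = true) :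
    invH (spanL [a, b, c]) = ((vecs 5).map fun v => nvL (digs a) (digs b) (digs c) v ^ 4).sum := by
  rw [invH, sum_vecs]
  congr 1
  apply List.map_congr_left
  intro v hv
  rw [nv_eval h (mem_vecs.1 hv).1]

lemma dot_toV (u w : List ℕ) (n : ℕ) (hu : u.length = n) (hw : w.length = n) :
    toV n u ⬝ᵥ toV n w = (dot u w : ZMod 3) := by
  induction n generalizing u w with
  | zero =>
    rw [List.length_eq_zero_iff] at hu hw
    subst hu hw
    simp [dot]
  | succ n ih =>
    cases u with
    | nil => simp at hu
    | cons a u =>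
    cases w with
    | nil => simp at hw
    | cons b w =>
    have := ih u w (by simpa using hu) (by simpa using hw)
    simp only [dot, dotProduct, Fin.sum_univ_succ] at this ⊢
    push_cast
    rw [← this]
    simp [toV]

def orthL (A B C u v : List ℕ) : Bool :=
  Nat.beq (dot u (mulL A v) % 3) 0 && (Nat.beq (dot u (mulL B v) % 3) 0 &&
    Nat.beq (dot u (mulL C v) % 3) 0)

lemma orth_eval (a b c : ℕ) {u v : List ℕ} (hu : u.length = 5) (hv : v.length = 5) :
    orth (spanL [a, b, c]) (toV 5 u) (toV 5 v) ↔
      orthL (digs a) (digs b) (digs c) u v = true := by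
  have key : ∀ x, toV 5 u ⬝ᵥ (asM (digs x) *ᵥ toV 5 v) = 0 ↔
      Nat.beq (dot u (mulL (digs x) v) % 3) 0 = true := by
    intro x
    rw [asM_mulVec _ _ (digs_length x) hv, dot_toV _ _ 5 hu (mulL_length _ _ (digs_length x) hv),
      ZMod.natCast_eq_zero_iff, Nat.dvd_iff_mod_eq_zero]
    exact (Nat.beq_eq ▸ Iff.rfl)
  rw [orthL, Bool.and_eq_true, Bool.and_eq_true, ← key, ← key, ← key]
  constructor
  · intro h
    exact ⟨h _ (mem_spanL (by simp)), h _ (mem_spanL (by simp)), h _ (mem_spanL (by simp))⟩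
  · rintro ⟨h1, h2, h3⟩ X hX
    rw [spanL_eq_range] at hX
    obtain ⟨x, rfl⟩ := hX
    rw [comb_apply, Matrix.add_mulVec, Matrix.add_mulVec,
      Matrix.smul_mulVec, Matrix.smul_mulVec, Matrix.smul_mulVec, dotProduct_add, dotProduct_add,
      dotProduct_smul, dotProduct_smul, dotProduct_smul, h1, h2, h3]
    simp

def gL (k : ℕ) (A B C : List ℕ) : ℕ :=
  (((vecs 5).filter fun v => Nat.beq (nvL A B C v) k).map fun u =>
    ((vecs 5).filter fun v => Nat.beq (nvL A B C v) k).countP fun v => orthL A B C u v).sum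

lemma sum_ite_countP (L : List (List ℕ)) (p : List ℕ → Bool) :
    (L.map fun l => if p l = true then 1 else 0).sum = L.countP p := by
  induction L with
  | nil => rfl
  | cons a L ih => rw [List.map_cons, List.sum_cons, ih, List.countP_cons, add_comm]

lemma invG_eval {a b c : ℕ} (h : indL (digs a) (digs b) (digs c) = true) (k : ℕ) :
    invG k (spanL [a, b, c]) = gL k (digs a) (digs b) (digs c) := by
  have hs : ∀ f : (Fin 5 → ZMod 3) → ℕ, ∑ v, f v = ((vecs 5).map fun l => f (toV 5 l)).sum :=
    sum_vecs
  have hlen : ∀ v ∈ vecs 5, v.length = 5 := fun v hv => (mem_vecs.1 hv).1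
  unfold invG gL
  generalize vecs 5 = L at hs hlen
  obtain ⟨p, hp⟩ : ∃ p : List ℕ → Bool,
    p = fun v => Nat.beq (nvL (digs a) (digs b) (digs c) v) k := ⟨_, rfl⟩
  have hb : ∀ v ∈ L, nv (spanL [a, b, c]) (toV 5 v) = k ↔ p v = true := by
    intro v hv
    rw [nv_eval h (hlen v hv), hp]
    exact (Nat.beq_eq ▸ Iff.rfl)
  rw [← hp]
  clear hp
  classical
  rw [hs, ← sum_filter_list]
  refine congrArg List.sum (List.map_congr_left fun u hu => ?_)
  rw [← sum_ite_countP, ← sum_filter_list, hs]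
  refine if_congr (hb u hu) (congrArg List.sum (List.map_congr_left fun v hv => ?_)) rfl
  exact if_congr (hb v hv) (if_congr (orth_eval a b c (hlen u hu) (hlen v hv)) rfl rfl) rfl

def radL (A B C : List ℕ) : Bool :=
  (vecs 5).all fun v => (v.all fun a => Nat.beq a 0) ||
    !((mulL A v).all (fun a => Nat.beq (a % 3) 0) && ((mulL B v).all (fun a => Nat.beq (a % 3) 0)
      && (mulL C v).all (fun a => Nat.beq (a % 3) 0)))

lemma toV_zero_iff (n : ℕ) (l : List ℕ) (h : l.length = n) :
    toV n l = 0 ↔ (l.all fun a => Nat.beq (a % 3) 0) = true := by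
  rw [List.all_eq_true]
  constructor
  · intro e a ha
    obtain ⟨i, hi, rfl⟩ := List.getElem_of_mem ha
    have := congrFun e ⟨i, h ▸ hi⟩
    simp only [toV, Pi.zero_apply] at this
    rw [List.getD_eq_getElem _ _ hi, ZMod.natCast_eq_zero_iff] at this
    rw [Nat.mod_eq_zero_of_dvd this]
    rfl
  · intro e
    ext i
    have hi : (i : ℕ) < l.length := by rw [h]; exact i.2
    simp only [toV, Pi.zero_apply]
    rw [List.getD_eq_getElem _ _ hi, ZMod.natCast_eq_zero_iff]
    exact Nat.dvd_of_mod_eq_zero (Nat.eq_of_beq_eq_true (e _ (List.getElem_mem hi)))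

lemma rad_eval (a b c : ℕ) :
    radOf (spanL [a, b, c]) = {0} ↔ radL (digs a) (digs b) (digs c) = true := by
  have hz : ∀ v ∈ vecs 5, (v.all fun a => Nat.beq a 0) = true ↔ toV 5 v = 0 := by
    intro v hv
    rw [toV_zero_iff 5 v (mem_vecs.1 hv).1, List.all_eq_true, List.all_eq_true]
    refine forall₂_congr fun x hx => ?_
    rw [Nat.mod_eq_of_lt ((mem_vecs.1 hv).2 x hx)]
  have hr : ∀ v ∈ vecs 5, ((mulL (digs a) v).all (fun a => Nat.beq (a % 3) 0) &&
      ((mulL (digs b) v).all (fun a => Nat.beq (a % 3) 0)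
      && (mulL (digs c) v).all (fun a => Nat.beq (a % 3) 0))) = true ↔
      toV 5 v ∈ radOf (spanL [a, b, c]) := by
    intro v hv
    have hl := (mem_vecs.1 hv).1
    rw [Bool.and_eq_true, Bool.and_eq_true, ← toV_zero_iff 5 _ (mulL_length _ _ (digs_length a) hl),
      ← toV_zero_iff 5 _ (mulL_length _ _ (digs_length b) hl),
      ← toV_zero_iff 5 _ (mulL_length _ _ (digs_length c) hl),
      ← asM_mulVec _ _ (digs_length a) hl, ← asM_mulVec _ _ (digs_length b) hl,
      ← asM_mulVec _ _ (digs_length c) hl]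
    constructor
    · rintro ⟨h1, h2, h3⟩ X hX
      rw [spanL_eq_range] at hX
      obtain ⟨x, rfl⟩ := hX
      rw [comb_apply, Matrix.add_mulVec, Matrix.add_mulVec,
        Matrix.smul_mulVec, Matrix.smul_mulVec, Matrix.smul_mulVec, h1, h2, h3]
      simp
    · intro h
      exact ⟨h _ (mem_spanL (by simp)), h _ (mem_spanL (by simp)), h _ (mem_spanL (by simp))⟩
  rw [radL, List.all_eq_true]
  constructor
  · intro h v hv
    rw [Bool.or_eq_true, Bool.not_eq_true', Bool.eq_false_iff, hz v hv, ne_eq, hr v hv, h,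
      Set.mem_singleton_iff]
    exact em _
  · intro h
    ext v
    obtain ⟨l, hl, rfl⟩ := exists_vecs v
    have := h l hl
    rw [Bool.or_eq_true, Bool.not_eq_true', Bool.eq_false_iff, hz l hl, ne_eq, hr l hl] at this
    rw [Set.mem_singleton_iff]
    constructor
    · intro h'
      exact this.resolve_right (fun hn => hn h')
    · intro e
      rw [e]
      intro X _
      exact Matrix.mulVec_zero _

/-- Codes of bases of the 22 representatives. -/
def tri : List (ℕ × ℕ × ℕ) :=
  [(1, 3, 9), (1, 3, 27), (1, 3, 36), (1, 3, 81), (1, 3, 810), (1, 3, 2430), (1, 3, 19683),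
   (1, 3, 19692), (1, 36, 87), (1, 36, 243), (1, 36, 810), (1, 36, 972), (1, 36, 6561),
   (1, 36, 6642), (1, 243, 7290), (1, 243, 7371), (1, 972, 6615), (1, 972, 6642), (1, 972, 8775),
   (36, 87, 972), (36, 810, 2208), (36, 810, 2430)]

/-- Values of the fourth moment invariant. -/
def hTab : List ℕ :=
  [4801923, 2106243, 1639683, 1682883, 628803, 591363, 643203, 591363, 1596483, 1602243, 585603,
   548163, 562563, 548163, 576963, 550083, 548163, 535683, 535683, 546243, 533763, 533763]

/-- Parameters for the secondary invariant. -/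
def kTab : List ℕ :=
  [0, 0, 0, 0, 0, 9, 0, 9, 0, 0, 0, 3, 0, 3, 0, 0, 3, 3, 3, 0, 3, 3]

/-- Values of the secondary invariant. -/
def gTab : List ℕ :=
  [0, 0, 0, 0, 0, 64, 0, 16, 0, 0, 0, 684, 0, 468, 0, 0, 612, 652, 676, 0, 676, 244]

def reps : List (List ℕ) := tri.map fun t => [t.1, t.2.1, t.2.2]

lemma ind_tri : (tri.all fun t => indL (digs t.1) (digs t.2.1) (digs t.2.2)) = true := by
  decide +kernel

lemma tri_length : tri.length = 22 := rfl

/-- The triple of codes with index `i`. -/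
def T (i : Fin 22) : ℕ × ℕ × ℕ := tri[(i : ℕ)]'(by rw [tri_length]; exact i.2)

lemma T_mem (i : Fin 22) : T i ∈ tri := List.getElem_mem _

lemma T_ind (i : Fin 22) : indL (digs (T i).1) (digs (T i).2.1) (digs (T i).2.2) = true :=
  List.all_eq_true.1 ind_tri _ (T_mem i)

lemma finrank_reps : ∀ r ∈ reps, Module.finrank (ZMod 3) (spanL r) = 3 := by
  intro r hr
  obtain ⟨t, ht, rfl⟩ := List.mem_map.1 hr
  exact finrank_eval (List.all_eq_true.1 ind_tri t ht)

def pencils : List (List ℕ) :=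
  [[1, 3], [1, 36], [1, 243], [1, 972], [36, 87], [36, 810]]

def firsts : List (List ℕ) := [[1], [36]]

def ms10 : List Mv :=
  [.cg 282817489142 282817489142, .cg 282817843435 282817666288, .cg 282817136305 282817136305,
   .cg 283075769467 282946629304, .cg 282560271697 282560271697, .cg 471103846795 376960667968,
   .cg 95305972465 95305972465, .cg 282817489870 282817489870, .cg 282817489147 282817489144,
   .cg 282817488657 282817488657, .cg 282818020582 282818020582, .cg 282903582583 282860535862]

def cs10 : List (ℕ × ℕ × ℕ × ℕ) :=
  [(1, 0, 282817489141, 282817489141), (36, 1, 282817489141, 282817489141)]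

lemma ok10 : (ms10.all fun m => m.ok []) = true := by decide +kernel

lemma chk10 :
    chk (ms10.map Mv.rows) ((0 :: cs10.map Prod.fst).map digs) 10 [] = true := by
  decide +kernel

lemma cert10 : (cs10.all fun c =>
    decide (c.2.1 < firsts.length) && certOK firsts [] c) = true := by
  decide +kernel

def ms20 : List Mv :=
  [.cg 252211270026 96726513774, .cg 96468765373 189449682733, .cg 778529535265 729857455390,
   .cg 283204910359 283204910359, .cg 597016037891 628397097500, .cg 660165045427 95693392954,
   .cg 345781321934 349210475005, .cg 282818021311 282818021311, .cg 471103846795 376960667968,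
   .cg 282817138492 282817313452, .cg 377004246859 492068132092, .cg 586555684688 576095331485,
   .cg 659864073404 764424558713, .cg 220859439675 107187398661, .cg 565763235626 565720363865,
   .cg 96468942279 189449741301, .tr 1 9 2]

def cs20 : List (ℕ × ℕ × ℕ × ℕ) :=
  [(3, 0, 282817489141, 282817489141), (36, 1, 282817489141, 282817489141),
   (243, 2, 282817489141, 282817489141), (972, 3, 282817489141, 282817489141)]

lemma ok20 : (ms20.all fun m => m.ok [1]) = true := by decide +kernel

lemma chk20 :
    chk (ms20.map Mv.rows) ((0 :: cs20.map Prod.fst).map digs) 10 [] = true := by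
  decide +kernel

lemma cert20 : (cs20.all fun c =>
    decide (c.2.1 < pencils.length) && certOK pencils [1] c) = true := by
  decide +kernel

def ms21 : List Mv :=
  [.cg 282689411861 282561866021, .cg 189448800643 96468058243, .cg 283205441071 283205441071,
   .cg 439981776830 471449107028, .cg 722669770784 754222840130, .cg 572867358851 568479250514,
   .tr 36 6 2, .cg 283204910359 283204910359, .cg 190309854620 699682882034,
   .cg 293277842344 303738195547, .cg 282846186955 282831838048, .cg 314084997524 380278040789]

def cs21 : List (ℕ × ℕ × ℕ × ℕ) :=
  [(1, 1, 282817489141, 282817489141), (9, 2, 564903716194, 564988396834),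
   (87, 4, 282817489141, 282817489141), (93, 4, 96081699178, 377736394681),
   (729, 3, 282445481901, 282558854061), (738, 3, 282474179716, 282558860407),
   (810, 5, 282817489141, 282817489141), (813, 5, 282817607239, 282817548190),
   (816, 5, 282817548190, 282817607239), (819, 5, 376961022748, 471104083234),
   (822, 5, 376961140846, 471104142283), (825, 5, 376961081797, 471104024185)]

lemma ok21 : (ms21.all fun m => m.ok [36]) = true := by decide +kernel

lemma chk21 :
    chk (ms21.map Mv.rows) ((0 :: cs21.map Prod.fst).map digs) 10 [] = true := by
  decide +kernel

lemma cert21 : (cs21.all fun c =>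
    decide (c.2.1 < pencils.length) && certOK pencils [36] c) = true := by
  decide +kernel

def ms30 : List Mv :=
  [.cg 282817489142 282817489142, .cg 376961022262 471104023942, .cg 345938331520 314370735877,
   .cg 565507963883 565121606276, .cg 303738195547 293277842344, .cg 659778157109 753921335936,
   .cg 565892727167 565892727167, .cg 282817548920 282817548920, .cg 565792816259 565907607515,
   .cg 283075769226 282946628823, .cg 565634977553 565634977553, .cg 597016037891 628397097500,
   .cg 572608547084 569121762683, .cg 569164986551 572694994820, .tr 3 8 2, .tr 1 9 2,
   .cg 565721071724 565678025003]

def cs30 : List (ℕ × ℕ × ℕ × ℕ) :=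
  [(9, 0, 282817489141, 282817489141), (27, 1, 282817489141, 282817489141),
   (36, 2, 282817489141, 282817489141), (81, 3, 282817489141, 282817489141),
   (810, 4, 282817489141, 282817489141), (2430, 5, 282817489141, 282817489141),
   (19683, 6, 282817489141, 282817489141), (19692, 7, 282817489141, 282817489141)]

lemma ok30 : (ms30.all fun m => m.ok [1, 3]) = true := by decide +kernel

lemma chk30 :
    chk (ms30.map Mv.rows) ((0 :: cs30.map Prod.fst).map digs) 10 [] = true := by
  decide +kernel

lemma cert30 : (cs30.all fun c =>
    decide (c.2.1 < reps.length) && certOK reps [1, 3] c) = true := by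
  decide +kernel

def ms31 : List Mv :=
  [.cg 282818021311 282818021311, .cg 189448800643 96468058243, .cg 380447806663 478077592744,
   .cg 565764177494 565922074520, .cg 565634978281 565634978281, .cg 691202617733 816769725743,
   .cg 283204910359 283204910359, .cg 659792860553 760923839234, .tr 36 6 2,
   .cg 282831838048 282846186955, .cg 282861068033 282861068033, .cg 286304391640 289791116992,
   .tr 1 9 2, .cg 190223643080 661328194088, .cg 293277842344 303738195547,
   .cg 282860535862 282903582583]

def cs31 : List (ℕ × ℕ × ℕ × ℕ) :=
  [(3, 2, 282689411860, 282561866020), (9, 3, 565634095462, 565634270422),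
   (87, 8, 282817489141, 282817489141), (93, 8, 754308228628, 97243077097),
   (243, 9, 282817489141, 282817489141), (729, 4, 282817018209, 282817134369),
   (738, 4, 282817018210, 282817138743), (810, 10, 282817489141, 282817489141),
   (819, 10, 95692921062, 660165283818), (972, 11, 282817489141, 282817489141),
   (6561, 12, 282817489141, 282817489141), (6642, 13, 282817489141, 282817489141)]

lemma ok31 : (ms31.all fun m => m.ok [1, 36]) = true := by decide +kernel

lemma chk31 :
    chk (ms31.map Mv.rows) ((0 :: cs31.map Prod.fst).map digs) 10 [] = true := by
  decide +kernel

lemma cert31 : (cs31.all fun c =>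
    decide (c.2.1 < reps.length) && certOK reps [1, 36] c) = true := by
  decide +kernel

def ms32 : List Mv :=
  [.cg 471103846796 376960667969, .cg 96468414724 189448976332, .cg 471879397091 96856540886,
   .cg 565634505160 565634564209, .cg 471103846795 376960667968, .cg 31427334343 21183776263,
   .tr 243 4 2, .cg 565634977553 565634977553, .cg 565634978525 565634978768,
   .cg 565663676096 565649327189, .cg 282818020582 282818020582, .cg 565635037331 565635096380,
   .cg 286304629294 289790708023, .tr 1 9 2, .cg 62857791722 62857791722]

def cs32 : List (ℕ × ℕ × ℕ × ℕ) :=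
  [(3, 3, 33705772813, 188377236253), (36, 9, 31433685391, 62853002191),
   (729, 6, 282445481901, 282558854061), (738, 12, 282817488657, 282817488657),
   (7290, 14, 282817489141, 282817489141), (7371, 15, 282817489141, 282817489141)]

lemma ok32 : (ms32.all fun m => m.ok [1, 243]) = true := by decide +kernel

lemma chk32 :
    chk (ms32.map Mv.rows) ((0 :: cs32.map Prod.fst).map digs) 10 [] = true := by
  decide +kernel

lemma cert32 : (cs32.all fun c =>
    decide (c.2.1 < reps.length) && certOK reps [1, 243] c) = true := by
  decide +kernel

def ms33 : List Mv :=
  [.cg 565634446112 565634446112, .cg 282817138492 282817313452, .cg 565635155429 565635332576,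
   .cg 283219258537 283219258537, .tr 972 3 2, .cg 565247026351 565247026351,
   .cg 502484906890 439722787429, .cg 628396565816 628396565816, .cg 659778157109 753921335936,
   .cg 576124088348 586570151693, .cg 286304273542 289791057943, .cg 293306599207 303752662552,
   .tr 1 9 2, .cg 345580141015 345580141015]

def cs33 : List (ℕ × ℕ × ℕ × ℕ) :=
  [(3, 4, 282560271697, 282560271697), (9, 5, 188549421198, 33708771678),
   (36, 11, 282817489141, 282817489141), (243, 6, 564876612705, 565117530705),
   (252, 12, 565721070513, 565649326218), (2187, 7, 94167095862, 63924558102),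
   (2190, 13, 95305971981, 95305971981), (2430, 7, 94170284508, 628783631064),
   (2433, 13, 95693392470, 660165044943), (6561, 12, 31404975237, 62795600757),
   (6588, 14, 345268715643, 627641401551), (6615, 16, 282817489141, 282817489141),
   (6642, 17, 282817489141, 282817489141), (6804, 14, 564970145643, 564893618118),
   (6831, 16, 597015505237, 597015506694), (6858, 12, 31405506921, 345225150360),
   (6885, 17, 96339093286, 409116569529), (8748, 15, 62779164702, 23383935954),
   (8775, 18, 282817489141, 282817489141), (8802, 17, 410795391167, 662360429173),
   (8829, 17, 567054988636, 568217250103), (8856, 15, 62779182199, 651005134695),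
   (8883, 18, 408858287747, 408858288474)]

lemma ok33 : (ms33.all fun m => m.ok [1, 972]) = true := by decide +kernel

lemma chk33 :
    chk (ms33.map Mv.rows) ((0 :: cs33.map Prod.fst).map digs) 10 [] = true := by
  decide +kernel

lemma cert33 : (cs33.all fun c =>
    decide (c.2.1 < reps.length) && certOK reps [1, 972] c) = true := by
  decide +kernel

def ms34 : List Mv :=
  [.cg 565634978281 565634978281, .cg 252297013303 127892164573, .cg 646189684589 635485873574,
   .cg 586684883900 576382427723, .cg 493316487002 828650443592, .cg 345669959161 31434217561,
   .tr 87 5 2, .tr 36 6 2, .cg 565634446112 565634446112, .cg 189449683463 96468766103,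
   .cg 286333089454 289805465899, .cg 282846186955 282831838048, .cg 307374031288 231603578722,
   .cg 10720799389 303870011869, .cg 314241244822 293535946981]

def cs34 : List (ℕ × ℕ × ℕ × ℕ) :=
  [(1, 8, 660552825313, 473816500993), (3, 9, 188338974688, 65087003008),
   (729, 16, 282447075510, 282687936390), (738, 16, 282447075996, 282687949512),
   (972, 19, 282817489141, 282817489141)]

lemma ok34 : (ms34.all fun m => m.ok [36, 87]) = true := by decide +kernel

lemma chk34 :
    chk (ms34.map Mv.rows) ((0 :: cs34.map Prod.fst).map digs) 10 [] = true := by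
  decide +kernel

lemma cert34 : (cs34.all fun c =>
    decide (c.2.1 < reps.length) && certOK reps [36, 87] c) = true := by
  decide +kernel

def ms35 : List Mv :=
  [.cg 565247557064 565247557064, .cg 376961495870 471104851601, .ng,
   .cg 345665701801 314241595471, .cg 565764118445 565893258608, .tr 810 3 2,
   .cg 565247026351 565247026351, .cg 196465353489 117517667175, .cg 659778629744 753921631667,
   .cg 111491068399 813627024246, .tr 36 6 2, .cg 586584382502 576109680392,
   .cg 565634446111 565634446111, .cg 286304273542 289791057943, .cg 176606407633 468578854701,
   .cg 189448679637 96467762277, .cg 314241595471 345665701801, .cg 690140919893 463284521135]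

def cs35 : List (ℕ × ℕ × ℕ × ℕ) :=
  [(1, 10, 95305500081, 95305500081), (3, 11, 282689411860, 282561866020),
   (9, 12, 282517224498, 282558748818), (84, 14, 753161377760, 627753935331),
   (87, 16, 564875016932, 564989867253), (90, 14, 753162972075, 596498539527),
   (93, 16, 659018196246, 596372882040), (96, 12, 94226086783, 346357348813),
   (243, 13, 62853002191, 31433685391), (244, 19, 282688177663, 282475776223),
   (245, 15, 346057918381, 628057513261), (252, 15, 282865331224, 282525734593),
   (253, 13, 62854066531, 597067599331), (254, 19, 345450298339, 471020414203),
   (2208, 20, 282817489141, 282817489141), (2430, 21, 282817489141, 282817489141),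
   (2439, 21, 3573423236, 318158859555), (2448, 21, 3573423956, 349152498675),
   (6561, 17, 3616114995, 7061258835), (6562, 21, 3874578876, 10847837196),
   (6642, 17, 3616116471, 195605896815), (6643, 21, 3917627784, 17950546161),
   (19926, 18, 21180187422, 10477930167), (19927, 21, 321215171735, 569207337166),
   (19928, 21, 493344919167, 396783849964), (19929, 21, 189448699349, 96473083248),
   (19930, 21, 510664048717, 110523155314), (19931, 18, 21180188170, 293424027300),
   (19935, 18, 21180187908, 167383228212), (19936, 21, 317728387332, 39216108214),
   (19937, 21, 500304138820, 651319111237), (19938, 21, 189477397649, 127854142857),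
   (19939, 21, 507205961888, 375518769790), (19940, 18, 21180188656, 450329325345),
   (19941, 21, 96482150849, 220835060217), (19942, 21, 414210894911, 363911941105),
   (19943, 18, 21180189377, 733275422478)]

lemma ok35 : (ms35.all fun m => m.ok [36, 810]) = true := by decide +kernel

lemma chk35 :
    chk (ms35.map Mv.rows) ((0 :: cs35.map Prod.fst).map digs) 10 [] = true := by
  decide +kernel

lemma cert35 : (cs35.all fun c =>
    decide (c.2.1 < reps.length) && certOK reps [36, 810] c) = true := by
  decide +kernel

theorem stage30 (y : List ℕ) (hy : y.length = 10) (h3 : ∀ a ∈ y, a < 3) :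
    Good reps [1, 3] y :=
  stage_last ms30 cs30 ok30 chk30 cert30 finrank_reps y hy h3

theorem stage31 (y : List ℕ) (hy : y.length = 10) (h3 : ∀ a ∈ y, a < 3) :
    Good reps [1, 36] y :=
  stage_last ms31 cs31 ok31 chk31 cert31 finrank_reps y hy h3

theorem stage32 (y : List ℕ) (hy : y.length = 10) (h3 : ∀ a ∈ y, a < 3) :
    Good reps [1, 243] y :=
  stage_last ms32 cs32 ok32 chk32 cert32 finrank_reps y hy h3

theorem stage33 (y : List ℕ) (hy : y.length = 10) (h3 : ∀ a ∈ y, a < 3) :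
    Good reps [1, 972] y :=
  stage_last ms33 cs33 ok33 chk33 cert33 finrank_reps y hy h3

theorem stage34 (y : List ℕ) (hy : y.length = 10) (h3 : ∀ a ∈ y, a < 3) :
    Good reps [36, 87] y :=
  stage_last ms34 cs34 ok34 chk34 cert34 finrank_reps y hy h3

theorem stage35 (y : List ℕ) (hy : y.length = 10) (h3 : ∀ a ∈ y, a < 3) :
    Good reps [36, 810] y :=
  stage_last ms35 cs35 ok35 chk35 cert35 finrank_reps y hy h3

lemma next2 : ∀ W ∈ pencils, W.length < 3 ∧
    ∀ y : List ℕ, y.length = 10 → (∀ a ∈ y, a < 3) → Good reps W y := by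
  intro W hW
  simp only [pencils, List.mem_cons, List.not_mem_nil, or_false] at hW
  rcases hW with rfl | rfl | rfl | rfl | rfl | rfl
  · exact ⟨by decide, stage30⟩
  · exact ⟨by decide, stage31⟩
  · exact ⟨by decide, stage32⟩
  · exact ⟨by decide, stage33⟩
  · exact ⟨by decide, stage34⟩
  · exact ⟨by decide, stage35⟩

theorem stage20 (y : List ℕ) (hy : y.length = 10) (h3 : ∀ a ∈ y, a < 3) :
    Good reps [1] y :=
  stage_next ms20 cs20 ok20 chk20 cert20 next2 y hy h3

theorem stage21 (y : List ℕ) (hy : y.length = 10) (h3 : ∀ a ∈ y, a < 3) :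
    Good reps [36] y :=
  stage_next ms21 cs21 ok21 chk21 cert21 next2 y hy h3

lemma next1 : ∀ W ∈ firsts, W.length < 3 ∧
    ∀ y : List ℕ, y.length = 10 → (∀ a ∈ y, a < 3) → Good reps W y := by
  intro W hW
  simp only [firsts, List.mem_cons, List.not_mem_nil, or_false] at hW
  rcases hW with rfl | rfl
  · exact ⟨by decide, stage20⟩
  · exact ⟨by decide, stage21⟩

theorem stage10 (y : List ℕ) (hy : y.length = 10) (h3 : ∀ a ∈ y, a < 3) :
    Good reps [] y :=
  stage_next ms10 cs10 ok10 chk10 cert10 next1 y hy h3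

lemma asM_anti (x : List ℕ) : (asM x)ᵀ = - asM x := by
  ext i j
  fin_cases i <;> fin_cases j <;> simp [asM]

lemma spanL_anti (U : List ℕ) : ∀ X ∈ spanL U, Xᵀ = -X := by
  intro X hX
  refine Submodule.span_induction (p := fun X _ => Xᵀ = -X) ?_ ?_ ?_ ?_ hX
  · rintro _ ⟨u, -, rfl⟩
    exact asM_anti _
  · simp
  · intro X Y _ _ h1 h2
    rw [Matrix.transpose_add, h1, h2, neg_add]
  · intro a X _ h
    rw [Matrix.transpose_smul, h, smul_neg]

/-- The representative subspaces. -/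
def repV (i : Fin 22) : Gr3AS5 :=
  ⟨spanL [(T i).1, (T i).2.1, (T i).2.2], spanL_anti _, finrank_eval (T_ind i)⟩

lemma congRel_map {V W : Gr3AS5} (h : congRel3AS5 V W) :
    ∃ P Q : M55, P * Q = 1 ∧ Q * P = 1 ∧ W.1 = V.1.map (cong P) := by
  obtain ⟨P, hP⟩ := h
  refine ⟨P, (P⁻¹ : GL (Fin 5) (ZMod 3)), ?_, ?_, ?_⟩
  · rw [← Units.val_mul, mul_inv_cancel, Units.val_one]
  · rw [← Units.val_mul, inv_mul_cancel, Units.val_one]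
  · apply SetLike.coe_injective
    rw [hP, Submodule.map_coe]
    rfl

lemma congRel_of_map {V W : Gr3AS5} {P Q : M55} (h1 : P * Q = 1) (h2 : Q * P = 1)
    (h : W.1 = V.1.map (cong P)) : congRel3AS5 V W := by
  refine ⟨⟨P, Q, h1, h2⟩, ?_⟩
  rw [h, Submodule.map_coe]
  rfl

lemma map_back {V W : Submodule (ZMod 3) M55} {P Q : M55} (h2 : Q * P = 1)
    (h : W = V.map (cong P)) : V = W.map (cong Q) := by
  rw [h, ← Submodule.map_comp]
  have : (cong Q).comp (cong P) = LinearMap.id := by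
    ext1 X
    exact cong_cong h2 X
  rw [this, Submodule.map_id]

noncomputable def qH : Quot congRel3AS5 → ℕ :=
  Quot.lift (fun V => invH V.1) fun V W h => by
    obtain ⟨P, Q, h1, h2, e⟩ := congRel_map h
    show invH V.1 = invH W.1
    rw [e, invH_map h1 h2]

noncomputable def qG (k : ℕ) : Quot congRel3AS5 → ℕ :=
  Quot.lift (fun V => invG k V.1) fun V W h => by
    obtain ⟨P, Q, h1, h2, e⟩ := congRel_map h
    show invG k V.1 = invG k W.1
    rw [e, invG_map h1 h2]

def qR : Quot congRel3AS5 → Prop :=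
  Quot.lift (fun V => radOf V.1 = {0}) fun V W h => by
    obtain ⟨P, Q, h1, h2, e⟩ := congRel_map h
    apply propext
    constructor
    · intro hr
      rw [e]
      exact rad_map h1 h2 _ hr
    · intro hr
      rw [map_back h2 e]
      exact rad_map h2 h1 _ hr

def hL (t : ℕ × ℕ × ℕ) : ℕ :=
  ((vecs 5).map fun v => nvL (digs t.1) (digs t.2.1) (digs t.2.2) v ^ 4).sum

lemma hTab_ok : ∀ i : Fin 22, hL (T i) = hTab.getD i 0 := by decide +kernel

lemma gTab_ok : ∀ i : Fin 22, kTab.getD i 0 ≠ 0 →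
    gL (kTab.getD i 0) (digs (T i).1) (digs (T i).2.1) (digs (T i).2.2) = gTab.getD i 0 := by
  decide +kernel

lemma tab_sep : ∀ i j : Fin 22, hTab.getD i 0 = hTab.getD j 0 → i = j ∨
    (kTab.getD i 0 ≠ 0 ∧ kTab.getD i 0 = kTab.getD j 0 ∧ gTab.getD i 0 ≠ gTab.getD j 0) := by
  decide +kernel

lemma rad_card : Fintype.card {i : Fin 22 //
    radL (digs (T i).1) (digs (T i).2.1) (digs (T i).2.2) = true} = 16 := by
  decide +kernel

def fQ (i : Fin 22) : Quot congRel3AS5 := Quot.mk _ (repV i)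

lemma qH_fQ (i : Fin 22) : qH (fQ i) = hTab.getD i 0 := by
  rw [← hTab_ok i]
  exact invH_eval (T_ind i)

lemma qG_fQ (k : ℕ) (i : Fin 22) :
    qG k (fQ i) = gL k (digs (T i).1) (digs (T i).2.1) (digs (T i).2.2) :=
  invG_eval (T_ind i) k

lemma qR_fQ (i : Fin 22) :
    qR (fQ i) ↔ radL (digs (T i).1) (digs (T i).2.1) (digs (T i).2.2) = true :=
  rad_eval _ _ _

lemma fQ_injective : Function.Injective fQ := by
  intro i j h
  have hh := congrArg qH h
  rw [qH_fQ, qH_fQ] at hh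
  rcases tab_sep i j hh with e | ⟨h1, h2, h3⟩
  · exact e
  · exfalso
    have hg := congrArg (qG (kTab.getD i 0)) h
    rw [qG_fQ, qG_fQ, gTab_ok i h1, h2, gTab_ok j (h2 ▸ h1)] at hg
    exact h3 hg

lemma hit_all (V : Gr3AS5) : Hit reps V.1 :=
  hit_of_good (W := []) (by simp) stage10 V.2.1 V.2.2 (spanL_le.2 (by simp))

lemma fQ_surjective : Function.Surjective fQ := by
  intro q
  induction q using Quot.ind with
  | _ V =>
    obtain ⟨r, hr, P, Q, h1, h2, e⟩ := hit_all V
    obtain ⟨t, ht, rfl⟩ := List.mem_map.1 hr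
    obtain ⟨i, hi, rfl⟩ := List.getElem_of_mem ht
    refine ⟨⟨i, by rw [← tri_length]; exact hi⟩, ?_⟩
    exact (Quot.sound (congRel_of_map h1 h2 e)).symm

noncomputable def eQ : Fin 22 ≃ Quot congRel3AS5 :=
  Equiv.ofBijective fQ ⟨fQ_injective, fQ_surjective⟩

lemma rad_pred (q : Quot congRel3AS5) :
    (∀ V : Gr3AS5, Quot.mk congRel3AS5 V = q → radOf V.1 = {0}) ↔ qR q := by
  constructor
  · intro h
    induction q using Quot.ind with
    | _ V => exact h V rfl
  · rintro h V rfl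
    exact h

lemma rad_pred' (q : Quot congRel3AS5) :
    (∀ V : Gr3AS5, Quot.mk congRel3AS5 V = q → radOf V.1 ≠ {0}) ↔ ¬ qR q := by
  constructor
  · intro h
    induction q using Quot.ind with
    | _ V => exact h V rfl
  · rintro h V rfl
    exact h

/-- The congruence action of `GL 5 (ZMod 3)` on 3-dimensional subspaces of antisymmetric
`5 × 5` matrices over `ZMod 3` has exactly 22 orbits; exactly 16 of them consist of subspaces
with trivial radical and exactly 6 of subspaces with nontrivial radical. -/
theorem three_dim_subspaces_of_AS5_orbit_count :
    Nat.card (Quot congRel3AS5) = 22 ∧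
    Nat.card {q : Quot congRel3AS5 //
      ∀ V : Gr3AS5, Quot.mk congRel3AS5 V = q → radOf V.1 = {0}} = 16 ∧
    Nat.card {q : Quot congRel3AS5 //
      ∀ V : Gr3AS5, Quot.mk congRel3AS5 V = q → radOf V.1 ≠ {0}} = 6 := by
  have hc := rad_card
  refine ⟨?_, ?_, ?_⟩
  · rw [← Nat.card_congr eQ, Nat.card_eq_fintype_card, Fintype.card_fin]
  · rw [← Nat.card_congr (Equiv.subtypeEquiv (p := fun i : Fin 22 =>
      radL (digs (T i).1) (digs (T i).2.1) (digs (T i).2.2) = true) eQ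
      (fun i => ((rad_pred (eQ i)).trans (qR_fQ i)).symm)), Nat.card_eq_fintype_card, hc]
  · rw [← Nat.card_congr (Equiv.subtypeEquiv (p := fun i : Fin 22 =>
      ¬ radL (digs (T i).1) (digs (T i).2.1) (digs (T i).2.2) = true) eQ
      (fun i => ((rad_pred' (eQ i)).trans (not_congr (qR_fQ i))).symm)),
      Nat.card_eq_fintype_card, Fintype.card_subtype_compl, hc, Fintype.card_fin]
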